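/- Theorem 3.1(A): In Algorithm 1 choose, for each t ∈ ℕ, θ_t = (t-1)/t, β_t = 2/(t+1), α_t = 1/(16(L_yx + L_yy + ρ σ_{y,Φ} √t)), and τ_t = t/(2(2L + (L_xx + L_yx) t + ρ'(σ_{x,Φ} + σ_{x,f}) t^{3/2})), where ρ, ρ' > 0 are arbitrary constants. If the gradient noises are unbiased with conditionally bounded second moments (bounds σ_{y,Φ}², σ_{x,Φ}², σ_{x,f}²), then for every T ≥ 3: E[G(x̄ᵀ, ȳᵀ)] ≤ B_E(T) := 16L Ω_{hX}/(T(T-1)) + 8(L_xx + L_yx) Ω_{hX}/T + 128(L_yx + L_yy) Ω_{hY}/T + (8σ_{y,Φ}/√T)(1/ρ + 16ρ Ω_{hY}) + (8(σ_{x,f} + σ_{x,Φ})/√T)(1/ρ' + ρ' Ω_{hX}). -/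

import Mathlib

open Filter Topology MeasureTheory ENNReal

section Preliminaries

variable {𝕌 : Type*} [NormedAddCommGroup 𝕌] [NormedSpace ℝ 𝕌]

/-- Convexity for extended-real-valued functions. -/
def EConvex (h : 𝕌 → EReal) : Prop :=
  ∀ u v : 𝕌, ∀ a b : ℝ, 0 ≤ a → 0 ≤ b → a + b = 1 →
    h (a • u + b • v) ≤ (a : EReal) * h u + (b : EReal) * h v

/-- A CCP (convex, closed, proper) extended-real-valued function. -/
def IsCCP (h : 𝕌 → EReal) : Prop :=
  EConvex h ∧ LowerSemicontinuous h ∧ (∀ u, h u ≠ ⊥) ∧ (∃ u, h u ≠ ⊤)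

/-- The effective domain of an extended-real-valued function. -/
def edom (h : 𝕌 → EReal) : Set 𝕌 := {u | h u < ⊤}

/-- The Bregman distance associated with `h` with gradient field `Dh`. -/
noncomputable def Dbreg (h : 𝕌 → EReal) (Dh : 𝕌 → 𝕌 →L[ℝ] ℝ) (u u' : 𝕌) : EReal :=
  h u - h u' - (((Dh u') (u - u') : ℝ) : EReal)

/-- Essential smoothness of `h` with gradient field `Dh`. -/
def EssentiallySmooth (h : 𝕌 → EReal) (Dh : 𝕌 → 𝕌 →L[ℝ] ℝ) : Prop :=
  (interior (edom h)).Nonempty ∧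
  (∀ u ∈ interior (edom h), HasFDerivAt (fun v => (h v).toReal) (Dh u) u) ∧
  ContinuousOn Dh (interior (edom h)) ∧
  ∀ u ∈ frontier (edom h), ∀ s : ℕ → 𝕌,
    (∀ n, s n ∈ interior (edom h)) → Tendsto s atTop (𝓝 u) →
      Tendsto (fun n => ‖Dh (s n)‖) atTop atTop

/-- `h` is a distance generating function (DGF) on `𝒰` with gradient field `Dh`. -/
def IsDGF (h : 𝕌 → EReal) (Dh : 𝕌 → 𝕌 →L[ℝ] ℝ) (𝒰 : Set 𝕌) : Prop :=
  IsCCP h ∧ ContinuousOn h 𝒰 ∧ EssentiallySmooth h Dh ∧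
  ∀ u ∈ 𝒰, ∀ u' ∈ 𝒰 ∩ interior (edom h),
    (((1 / 2 * ‖u - u'‖ ^ 2 : ℝ)) : EReal) ≤ Dbreg h Dh u u'

/-- Conversion of an extended real to `ℝ≥0∞` (for taking expectations of the duality gap,
which is nonnegative). -/
noncomputable def toENN (x : EReal) : ℝ≥0∞ := if x = ⊤ then ⊤ else ENNReal.ofReal x.toReal

end Preliminaries

section SaddlePoint

variable {𝕏 𝕐 : Type*} [NormedAddCommGroup 𝕏] [NormedSpace ℝ 𝕏]
  [NormedAddCommGroup 𝕐] [NormedSpace ℝ 𝕐]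

/-- The saddle function `S(x,y) = f(x) + g(x) + Φ(x,y) - J(y)`. -/
noncomputable def spS (f : 𝕏 → ℝ) (g : 𝕏 → EReal) (Φ : 𝕏 → 𝕐 → ℝ) (J : 𝕐 → EReal)
    (x : 𝕏) (y : 𝕐) : EReal :=
  ((f x : ℝ) : EReal) + g x + ((Φ x y : ℝ) : EReal) - J y

/-- The duality gap `G(x,y) = sup_{y'∈Y} S(x,y') - inf_{x'∈X} S(x',y)`. -/
noncomputable def spGap (X : Set 𝕏) (Y : Set 𝕐) (f : 𝕏 → ℝ) (g : 𝕏 → EReal)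
    (Φ : 𝕏 → 𝕐 → ℝ) (J : 𝕐 → EReal) (x : 𝕏) (y : 𝕐) : EReal :=
  (⨆ y' ∈ Y, spS f g Φ J x y') - (⨅ x' ∈ X, spS f g Φ J x' y)

end SaddlePoint

section Helpers

variable {E : Type*} [NormedAddCommGroup E] [NormedSpace ℝ E]

/-- If increments along a ray dominate `s * c`, the derivative dominates `c`. -/
lemma aux_le_deriv {φ : E → ℝ} {φ' : E →L[ℝ] ℝ} {x d : E} {c : ℝ}
    (h : HasFDerivAt φ φ' x)
    (H : ∀ s : ℝ, 0 < s → s ≤ 1 → s * c ≤ φ (x + s • d) - φ x) : c ≤ φ' d := by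
  have hd : HasDerivAt (fun s : ℝ => φ (x + s • d)) (φ' d) 0 := by
    have h1 : HasDerivAt (fun s : ℝ => x + s • d) d 0 := by
      simpa using ((hasDerivAt_id (0 : ℝ)).smul_const d).const_add x
    have h2 : HasFDerivAt φ φ' (x + (0 : ℝ) • d) := by simpa using h
    exact h2.comp_hasDerivAt (0 : ℝ) h1
  have ht := hd.tendsto_slope_zero_right
  refine ge_of_tendsto ht ?_
  have : Set.Ioc (0 : ℝ) 1 ∈ 𝓝[>] (0 : ℝ) := Ioc_mem_nhdsGT (by norm_num)
  filter_upwards [this] with s hs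
  have := H s hs.1 hs.2
  simp only [zero_add, zero_smul, add_zero, smul_eq_mul]
  rw [inv_mul_eq_div, le_div_iff₀ hs.1]
  linarith

lemma aux_grad_ineq {K : Set E} {f : E → ℝ} {f' : E →L[ℝ] ℝ} {x y : E}
    (hf : ConvexOn ℝ K f) (hx : x ∈ K) (hy : y ∈ K) (h : HasFDerivAt f f' x) :
    f x + f' (y - x) ≤ f y := by
  have h2 : HasFDerivAt (fun z => - f z) (-f') x := h.neg
  have := aux_le_deriv (d := y - x) (c := f x - f y) h2 (by
    intro s hs hs1
    have := hf.2 hx hy (by linarith : (0:ℝ) ≤ 1 - s) hs.le (by ring)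
    have e : (1 - s) • x + s • y = x + s • (y - x) := by module
    rw [e] at this
    simp only [smul_eq_mul] at this
    linarith)
  simp only [neg_apply] at this
  linarith

lemma aux_descent {K : Set E} {f : E → ℝ} {Df : E → E →L[ℝ] ℝ} {L : ℝ}
    (hK : Convex ℝ K) (hd : ∀ x ∈ K, HasFDerivAt f (Df x) x)
    (hL : ∀ x ∈ K, ∀ x' ∈ K, ‖Df x - Df x'‖ ≤ L * ‖x - x'‖)
    {x y : E} (hx : x ∈ K) (hy : y ∈ K) :
    f y ≤ f x + Df x (y - x) + L / 2 * ‖y - x‖ ^ 2 := by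
  set d := y - x with hdd
  have hmem : ∀ s ∈ Set.Icc (0:ℝ) 1, x + s • d ∈ K := fun s hs => by
    have := hK hx hy (by linarith [hs.2] : (0:ℝ) ≤ 1 - s) hs.1 (by ring)
    have e : (1 - s) • x + s • y = x + s • d := by rw [hdd]; module
    rwa [e] at this
  have hder : ∀ s ∈ Set.Icc (0:ℝ) 1, HasDerivAt
      (fun s : ℝ => f (x + s • d) - s * Df x d - L / 2 * s ^ 2 * ‖d‖ ^ 2)
      (Df (x + s • d) d - Df x d - L * s * ‖d‖ ^ 2) s := by
    intro s hs
    have h1 : HasDerivAt (fun s : ℝ => x + s • d) d s := by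
      simpa using ((hasDerivAt_id s).smul_const d).const_add x
    have h2 := (hd _ (hmem s hs)).comp_hasDerivAt s h1
    have h3 := (hasDerivAt_id s).mul_const (Df x d)
    have h4 := (((hasDerivAt_id s).pow 2).const_mul (L / 2)).mul_const (‖d‖ ^ 2)
    have h5 := (h2.sub h3).sub h4
    refine h5.congr_deriv ?_
    simp only [id, Nat.add_one_sub_one, pow_one, Nat.cast_ofNat]; ring
  have anti : AntitoneOn (fun s : ℝ => f (x + s • d) - s * Df x d - L / 2 * s ^ 2 * ‖d‖ ^ 2)
      (Set.Icc 0 1) := by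
    apply antitoneOn_of_deriv_nonpos (convex_Icc 0 1)
    · exact fun s hs => (hder s hs).continuousAt.continuousWithinAt
    · intro s hs
      rw [interior_Icc] at hs
      exact (hder s (Set.Ioo_subset_Icc_self hs)).differentiableAt.differentiableWithinAt
    · intro s hs
      rw [interior_Icc] at hs
      have hs' := Set.Ioo_subset_Icc_self hs
      rw [(hder s hs').deriv]
      have h1 : (Df (x + s • d) - Df x) d ≤ ‖Df (x + s • d) - Df x‖ * ‖d‖ :=
        (le_abs_self _).trans ((Df (x + s • d) - Df x).le_opNorm d)
      have h2 := hL _ (hmem s hs') x hx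
      have h3 : ‖x + s • d - x‖ = s * ‖d‖ := by
        rw [add_sub_cancel_left, norm_smul, Real.norm_of_nonneg hs.1.le]
      rw [h3] at h2
      have h4 := mul_le_mul_of_nonneg_right h2 (norm_nonneg d)
      simp only [sub_apply] at h1
      nlinarith
  have := anti (Set.left_mem_Icc.2 zero_le_one) (Set.right_mem_Icc.2 zero_le_one) zero_le_one
  simp only [one_smul, zero_smul, add_zero] at this
  have e : x + d = y := by rw [hdd]; abel
  rw [e] at this
  linarith

/-- The smooth part. -/
lemma aux_f_part {K : Set E} {f : E → ℝ} {Df : E → E →L[ℝ] ℝ} {L : ℝ}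
    (hK : Convex ℝ K) (hc : ConvexOn ℝ K f) (hd : ∀ x ∈ K, HasFDerivAt f (Df x) x)
    (hL : ∀ x ∈ K, ∀ x' ∈ K, ‖Df x - Df x'‖ ≤ L * ‖x - x'‖)
    {b : ℝ} (hb0 : 0 ≤ b) (hb1 : b ≤ 1) {xb xk xp x xt xbp : E}
    (hxb : xb ∈ K) (hxk : xk ∈ K) (hxp : xp ∈ K) (hx : x ∈ K)
    (ht : xt = (1 - b) • xb + b • xk) (hbp : xbp = (1 - b) • xb + b • xp) :
    f xbp ≤ (1 - b) * f xb + b * (f x + Df xt (xp - x)) + L * b ^ 2 / 2 * ‖xp - xk‖ ^ 2 := by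
  have hxt : xt ∈ K := ht ▸ hK hxb hxk (by linarith) hb0 (by ring)
  have hxbp : xbp ∈ K := hbp ▸ hK hxb hxp (by linarith) hb0 (by ring)
  have h1 := aux_descent hK hd hL hxt hxbp
  have e : xbp - xt = b • (xp - xk) := by rw [ht, hbp]; module
  have e2 : Df xt (xbp - xt) = (1 - b) * Df xt (xb - xt) + b * Df xt (xp - x)
      + b * Df xt (x - xt) := by
    have : xbp - xt = (1 - b) • (xb - xt) + b • (xp - x) + b • (x - xt) := by
      rw [hbp]; module
    rw [this]; simp
  rw [e2, e, norm_smul, Real.norm_of_nonneg hb0, mul_pow] at h1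
  have g1 := mul_le_mul_of_nonneg_left (aux_grad_ineq hc hxt hxb (hd _ hxt))
    (by linarith : 0 ≤ 1 - b)
  have g2 := mul_le_mul_of_nonneg_left (aux_grad_ineq hc hxt hx (hd _ hxt)) hb0
  linarith

/-- Prox three-point inequality, real-valued. -/
lemma aux_prox {G : E → ℝ} {h : E → ℝ} {h' hk' ξ : E →L[ℝ] ℝ}
    {b : ℝ} (hb : 0 < b) {p x xk : E}
    (hd : HasFDerivAt h h' p)
    (hG : ∀ s : ℝ, 0 < s → s ≤ 1 → G (p + s • (x - p)) ≤ (1 - s) * G p + s * G x)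
    (hopt : ∀ s : ℝ, 0 < s → s ≤ 1 →
      G p + ξ (p - xk) + b * (h p - h xk - hk' (p - xk)) ≤
      G (p + s • (x - p)) + ξ (p + s • (x - p) - xk)
        + b * (h (p + s • (x - p)) - h xk - hk' (p + s • (x - p) - xk))) :
    G p - G x + ξ (p - x) ≤ b * ((h x - h xk - hk' (x - xk)) - (h p - h xk - hk' (p - xk))
      - (h x - h p - h' (x - p))) := by
  have key := aux_le_deriv (d := x - p) (c := (G p - G x - ξ (x - p)) / b + hk' (x - p)) hd (by
    intro s hs hs1
    have h1 := hG s hs hs1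
    have h2 := hopt s hs hs1
    have e1 : p + s • (x - p) - xk = (p - xk) + s • (x - p) := by abel
    rw [e1] at h2
    simp only [map_add, map_smul, smul_eq_mul] at h2
    have h3 : s * (G p - G x - ξ (x - p)) + b * (s * hk' (x - p)) ≤
        b * (h (p + s • (x - p)) - h p) := by nlinarith
    have h4 : b * (s * ((G p - G x - ξ (x - p)) / b + hk' (x - p))) =
        s * (G p - G x - ξ (x - p)) + b * (s * hk' (x - p)) := by field_simp
    rw [← h4] at h3
    exact le_of_mul_le_mul_left h3 hb)
  have k2 := mul_le_mul_of_nonneg_left key hb.le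
  have k3 : b * ((G p - G x - ξ (x - p)) / b + hk' (x - p)) =
      (G p - G x - ξ (x - p)) + b * hk' (x - p) := by field_simp
  rw [k3] at k2
  have e2 : hk' (x - xk) = hk' (x - p) + hk' (p - xk) := by
    rw [← map_add]; congr 1; abel
  have e3 : ξ (p - x) = - ξ (x - p) := by rw [← map_neg]; congr 1; abel
  rw [e2, e3]
  linarith

end Helpers

section DGF

variable {E : Type*} [NormedAddCommGroup E] [NormedSpace ℝ E]

/-- Real-valued Bregman distance. -/
noncomputable def rD (h : E → EReal) (Dh : E → E →L[ℝ] ℝ) (u u' : E) : ℝ :=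
  (h u).toReal - (h u').toReal - Dh u' (u - u')

lemma dgf_coe {h : E → EReal} {Dh : E → E →L[ℝ] ℝ} {K : Set E} {Om : ℝ}
    (hh : IsDGF h Dh K) (x0 : E) (hx0 : x0 ∈ K ∩ interior (edom h))
    (hO : (⨆ x ∈ K, ⨆ x' ∈ K ∩ interior (edom h), Dbreg h Dh x x') = (Om : EReal)) :
    ∀ u ∈ K, h u = ((h u).toReal : EReal) := by
  intro u hu
  have hb : h u ≠ ⊥ := hh.1.2.2.1 u
  have h0b : h x0 ≠ ⊥ := hh.1.2.2.1 x0
  have h0m : x0 ∈ edom h := interior_subset hx0.2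
  have h0t : h x0 ≠ ⊤ := LT.lt.ne h0m
  have hle : Dbreg h Dh u x0 ≤ (Om : EReal) := by
    rw [← hO]
    exact le_iSup₂_of_le u hu (le_iSup₂_of_le x0 hx0 le_rfl)
  refine (EReal.coe_toReal ?_ hb).symm
  intro ht
  unfold Dbreg at hle
  rw [ht, ← EReal.coe_toReal h0t h0b, EReal.top_sub_coe, EReal.top_sub_coe] at hle
  exact absurd hle (not_le.2 (EReal.coe_lt_top _))

lemma dgf_breg {h : E → EReal} {Dh : E → E →L[ℝ] ℝ} {K : Set E}
    (hc : ∀ u ∈ K, h u = ((h u).toReal : EReal)) {u u' : E} (hu : u ∈ K) (hu' : u' ∈ K) :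
    Dbreg h Dh u u' = (rD h Dh u u' : EReal) := by
  unfold Dbreg rD
  rw [hc u hu, hc u' hu']
  simp

lemma dgf_bounds {h : E → EReal} {Dh : E → E →L[ℝ] ℝ} {K : Set E} {Om : ℝ}
    (hh : IsDGF h Dh K)
    (hO : (⨆ x ∈ K, ⨆ x' ∈ K ∩ interior (edom h), Dbreg h Dh x x') = (Om : EReal))
    (hc : ∀ u ∈ K, h u = ((h u).toReal : EReal)) {u u' : E} (hu : u ∈ K)
    (hu' : u' ∈ K ∩ interior (edom h)) :
    1 / 2 * ‖u - u'‖ ^ 2 ≤ rD h Dh u u' ∧ rD h Dh u u' ≤ Om := by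
  have h1 := hh.2.2.2 u hu u' hu'
  have h2 : Dbreg h Dh u u' ≤ (Om : EReal) := by
    rw [← hO]
    exact le_iSup₂_of_le u hu (le_iSup₂_of_le u' hu' le_rfl)
  rw [dgf_breg hc hu hu'.1] at h1 h2
  exact ⟨EReal.coe_le_coe_iff.1 h1, EReal.coe_le_coe_iff.1 h2⟩

lemma edom_convex {h : E → EReal} (hh : IsCCP h) : Convex ℝ (edom h) := by
  intro u hu v hv a b ha hb hab
  have hu' : h u < ⊤ := hu
  have hv' : h v < ⊤ := hv
  change h (a • u + b • v) < ⊤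
  refine (hh.1 u v a b ha hb hab).trans_lt ?_
  rw [← EReal.coe_toReal hu'.ne (hh.2.2.1 u), ← EReal.coe_toReal hv'.ne (hh.2.2.1 v)]
  exact_mod_cast EReal.coe_lt_top _

lemma ccp_toReal_convex {h : E → EReal} (hh : IsCCP h) {u v : E} (hu : u ∈ edom h)
    (hv : v ∈ edom h) {a b : ℝ} (ha : 0 ≤ a) (hb : 0 ≤ b) (hab : a + b = 1) :
    (h (a • u + b • v)).toReal ≤ a * (h u).toReal + b * (h v).toReal := by
  have hu' : h u < ⊤ := hu
  have hv' : h v < ⊤ := hv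
  have hw : h (a • u + b • v) < ⊤ := edom_convex hh hu hv ha hb hab
  have := hh.1 u v a b ha hb hab
  rw [← EReal.coe_toReal hu'.ne (hh.2.2.1 u), ← EReal.coe_toReal hv'.ne (hh.2.2.1 v),
    ← EReal.coe_toReal hw.ne (hh.2.2.1 _)] at this
  exact_mod_cast this

lemma dgf_contOn {h : E → EReal} {Dh : E → E →L[ℝ] ℝ} {K : Set E}
    (hh : IsDGF h Dh K)
    (hc : ∀ u ∈ K, h u = ((h u).toReal : EReal)) :
    ContinuousOn (fun u => (h u).toReal) K := by
  intro u hu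
  have h1 := hh.2.1 u hu
  have h2 : ContinuousAt EReal.toReal (h u) := by
    have := hc u hu
    refine EReal.tendsto_toReal ?_ ?_
    · rw [this]; exact EReal.coe_ne_top _
    · rw [this]; exact EReal.coe_ne_bot _
  exact h2.comp_continuousWithinAt h1

/-- Strong convexity of a DGF. -/
lemma dgf_strong {h : E → EReal} {Dh : E → E →L[ℝ] ℝ} {K : Set E} {Om : ℝ}
    (hK : Convex ℝ K)
    (hh : IsDGF h Dh K) (x0 : E) (hx0 : x0 ∈ K ∩ interior (edom h))
    (hO : (⨆ x ∈ K, ⨆ x' ∈ K ∩ interior (edom h), Dbreg h Dh x x') = (Om : EReal))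
    {u w : E} (hu : u ∈ K) (hw : w ∈ K) {s : ℝ} (hs0 : 0 ≤ s) (hs1 : s ≤ 1) :
    (h (u + s • (w - u))).toReal ≤ (1 - s) * (h u).toReal + s * (h w).toReal
      - 1 / 2 * (s * (1 - s)) * ‖w - u‖ ^ 2 := by
  have hc := dgf_coe hh x0 hx0 hO
  have hcont := dgf_contOn hh hc
  have hdom : K ⊆ edom h := fun v hv => by
    change h v < ⊤
    rw [hc v hv]; exact EReal.coe_lt_top _
  set m := u + s • (w - u) with hm
  have hmK : m ∈ K := by
    have := hK hu hw (by linarith : 0 ≤ 1 - s) hs0 (by ring)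
    have e : (1 - s) • u + s • w = m := by rw [hm]; module
    rwa [e] at this
  -- shifted points
  have hmem : ∀ v ∈ K, ∀ e ∈ Set.Icc (0:ℝ) 1, v + e • (x0 - v) ∈ K := fun v hv e he => by
    have := hK hv hx0.1 (by linarith [he.2] : 0 ≤ 1 - e) he.1 (by ring)
    have e' : (1 - e) • v + e • x0 = v + e • (x0 - v) := by module
    rwa [e'] at this
  have hlim : ∀ v ∈ K, Tendsto (fun e : ℝ => (h (v + e • (x0 - v))).toReal) (𝓝[>] 0)
      (𝓝 (h v).toReal) := by
    intro v hv
    have h1 : Tendsto (fun e : ℝ => v + e • (x0 - v)) (𝓝[>] 0) (𝓝[K] v) := by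
      refine tendsto_nhdsWithin_iff.2 ⟨?_, ?_⟩
      · have : Continuous (fun e : ℝ => v + e • (x0 - v)) := by fun_prop
        have := (this.tendsto 0).mono_left (nhdsWithin_le_nhds (s := Set.Ioi 0))
        simpa using this
      · filter_upwards [Ioc_mem_nhdsGT (zero_lt_one' ℝ)] with e he
        exact hmem v hv e ⟨he.1.le, he.2⟩
    exact (hcont v hv).tendsto.comp h1
  have hineq : ∀ e ∈ Set.Ioc (0:ℝ) 1, (h (m + e • (x0 - m))).toReal ≤
      (1 - s) * (h (u + e • (x0 - u))).toReal + s * (h (w + e • (x0 - w))).toReal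
      - 1 / 2 * (s * (1 - s)) * (1 - e) ^ 2 * ‖w - u‖ ^ 2 := by
    intro e he
    have he' : e ∈ Set.Icc (0:ℝ) 1 := ⟨he.1.le, he.2⟩
    have hmi : m + e • (x0 - m) ∈ K ∩ interior (edom h) := by
      refine ⟨hmem m hmK e he', ?_⟩
      have := (edom_convex hh.1).combo_interior_self_mem_interior hx0.2 (hdom hmK) he.1
        (by linarith [he.2] : 0 ≤ 1 - e) (by ring)
      have e' : e • x0 + (1 - e) • m = m + e • (x0 - m) := by module
      rwa [e'] at this
    have b1 := (dgf_bounds hh hO hc (hmem u hu e he') hmi).1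
    have b2 := (dgf_bounds hh hO hc (hmem w hw e he') hmi).1
    unfold rD at b1 b2
    have e1 : u + e • (x0 - u) - (m + e • (x0 - m)) = (-(s * (1 - e))) • (w - u) := by
      rw [hm]; module
    have e2 : w + e • (x0 - w) - (m + e • (x0 - m)) = ((1 - s) * (1 - e)) • (w - u) := by
      rw [hm]; module
    rw [e1] at b1
    rw [e2] at b2
    rw [norm_smul, mul_pow, map_smul, smul_eq_mul, Real.norm_eq_abs, sq_abs] at b1 b2
    have c1 := mul_le_mul_of_nonneg_left b1 (by linarith : 0 ≤ 1 - s)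
    have c2 := mul_le_mul_of_nonneg_left b2 hs0
    nlinarith
  have hR : Tendsto (fun e : ℝ =>
      (1 - s) * (h (u + e • (x0 - u))).toReal + s * (h (w + e • (x0 - w))).toReal
      - 1 / 2 * (s * (1 - s)) * (1 - e) ^ 2 * ‖w - u‖ ^ 2) (𝓝[>] 0)
      (𝓝 ((1 - s) * (h u).toReal + s * (h w).toReal
      - 1 / 2 * (s * (1 - s)) * (1 - 0) ^ 2 * ‖w - u‖ ^ 2)) := by
    refine (((hlim u hu).const_mul _).add ((hlim w hw).const_mul _)).sub ?_
    have : Continuous (fun e : ℝ => 1 / 2 * (s * (1 - s)) * (1 - e) ^ 2 * ‖w - u‖ ^ 2) := by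
      fun_prop
    exact (this.tendsto 0).mono_left nhdsWithin_le_nhds
  have := le_of_tendsto_of_tendsto (hlim m hmK) hR (by
    filter_upwards [Ioc_mem_nhdsGT (zero_lt_one' ℝ)] with e he using hineq e he)
  simpa using this

lemma dgf_compact [FiniteDimensional ℝ E] {h : E → EReal} {Dh : E → E →L[ℝ] ℝ} {K : Set E}
    {Om : ℝ} (hcl : IsClosed K)
    (hh : IsDGF h Dh K) (x0 : E) (hx0 : x0 ∈ K ∩ interior (edom h))
    (hO : (⨆ x ∈ K, ⨆ x' ∈ K ∩ interior (edom h), Dbreg h Dh x x') = (Om : EReal)) :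
    IsCompact K := by
  have : ProperSpace E := FiniteDimensional.proper ℝ E
  refine Metric.isCompact_of_isClosed_isBounded hcl ?_
  refine (Metric.isBounded_iff_subset_closedBall x0).2 ⟨2 * Om + 1, fun u hu => ?_⟩
  have hb := dgf_bounds hh hO (dgf_coe hh x0 hx0 hO) hu hx0
  rw [Metric.mem_closedBall, dist_eq_norm]
  have := hb.1.trans hb.2
  nlinarith [sq_nonneg (‖u - x0‖ - 1)]

/-- Dual averaging regret bound with a continuous selection of maximizers. -/
lemma dgf_regret [FiniteDimensional ℝ E] {h : E → EReal} {Dh : E → E →L[ℝ] ℝ} {K : Set E}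
    {Om : ℝ} (hcl : IsClosed K) (hK : Convex ℝ K)
    (hh : IsDGF h Dh K) (x0 : E) (hx0 : x0 ∈ K ∩ interior (edom h))
    (hO : (⨆ x ∈ K, ⨆ x' ∈ K ∩ interior (edom h), Dbreg h Dh x x') = (Om : EReal)) :
    ∃ v : (E →L[ℝ] ℝ) → E, Continuous v ∧ (∀ z, v z ∈ K) ∧
      ∀ (lam : ℝ), 0 < lam → ∀ (δ : ℕ → E →L[ℝ] ℝ) (n : ℕ), ∀ x ∈ K,
        ∑ i ∈ Finset.range n, δ i x ≤ lam * Om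
          + ∑ i ∈ Finset.range n, δ i (v (lam⁻¹ • ∑ j ∈ Finset.range i, δ j))
          + 1 / (2 * lam) * ∑ i ∈ Finset.range n, ‖δ i‖ ^ 2 := by
  have hc := dgf_coe hh x0 hx0 hO
  have hcont := dgf_contOn hh hc
  have hcomp := dgf_compact hcl hh x0 hx0 hO
  set d : E → ℝ := fun x => rD h Dh x x0 with hd
  have hd0 : ∀ x ∈ K, 0 ≤ d x ∧ d x ≤ Om := fun x hx => by
    have := dgf_bounds hh hO hc hx hx0
    exact ⟨le_trans (by positivity) this.1, this.2⟩
  have hdc : ContinuousOn d K := by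
    rw [hd]; unfold rD
    refine (hcont.sub continuousOn_const).sub ?_
    exact Continuous.continuousOn (by fun_prop)
  have hex : ∀ z : E →L[ℝ] ℝ, ∃ v ∈ K, ∀ x ∈ K, z x - d x ≤ z v - d v := by
    intro z
    obtain ⟨v, hv, hm⟩ := hcomp.exists_isMaxOn ⟨x0, hx0.1⟩
      ((z.continuous.continuousOn (s := K)).sub hdc)
    exact ⟨v, hv, fun x hx => hm hx⟩
  choose v hvK hvm using hex
  have hstr : ∀ z, ∀ x ∈ K, z x - d x + 1 / 2 * ‖x - v z‖ ^ 2 ≤ z (v z) - d (v z) := by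
    intro z x hx
    have key : ∀ s ∈ Set.Ioc (0:ℝ) 1, z x - d x + 1 / 2 * (1 - s) * ‖x - v z‖ ^ 2
        ≤ z (v z) - d (v z) := by
      intro s hs
      have h1 := dgf_strong hK hh x0 hx0 hO (hvK z) hx hs.1.le hs.2
      have hmem : v z + s • (x - v z) ∈ K := by
        have := hK (hvK z) hx (by linarith [hs.2] : 0 ≤ 1 - s) hs.1.le (by ring)
        have e : (1 - s) • v z + s • x = v z + s • (x - v z) := by module
        rwa [e] at this
      have h2 := hvm z _ hmem
      have h3 : d (v z + s • (x - v z)) ≤ (1 - s) * d (v z) + s * d x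
          - 1 / 2 * (s * (1 - s)) * ‖x - v z‖ ^ 2 := by
        have e1 : Dh x0 (v z + s • (x - v z) - x0) =
            (1 - s) * Dh x0 (v z - x0) + s * Dh x0 (x - x0) := by
          have : v z + s • (x - v z) - x0 = (1 - s) • (v z - x0) + s • (x - x0) := by module
          rw [this]; simp
        simp only [hd, rD]
        rw [e1]
        linarith
      simp only [map_add, map_smul, smul_eq_mul, map_sub] at h2
      have h4 : s * (z x - d x + 1 / 2 * (1 - s) * ‖x - v z‖ ^ 2) ≤ s * (z (v z) - d (v z)) := by
        nlinarith
      exact le_of_mul_le_mul_left h4 hs.1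
    have hl : Tendsto (fun s : ℝ => z x - d x + 1 / 2 * (1 - s) * ‖x - v z‖ ^ 2) (𝓝[>] 0)
        (𝓝 (z x - d x + 1 / 2 * (1 - 0) * ‖x - v z‖ ^ 2)) := by
      have : Continuous (fun s : ℝ => z x - d x + 1 / 2 * (1 - s) * ‖x - v z‖ ^ 2) := by
        fun_prop
      exact (this.tendsto 0).mono_left nhdsWithin_le_nhds
    have := le_of_tendsto hl (by
      filter_upwards [Ioc_mem_nhdsGT (zero_lt_one' ℝ)] with e he using key e he)
    simpa using this
  refine ⟨v, ?_, hvK, ?_⟩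
  · have : LipschitzWith 1 v := by
      refine LipschitzWith.of_dist_le_mul fun z z' => ?_
      rw [dist_eq_norm, dist_eq_norm, NNReal.coe_one, one_mul]
      have h1 := hstr z (v z') (hvK z')
      have h2 := hstr z' (v z) (hvK z)
      rw [norm_sub_rev] at h1
      have h3 : (z - z') (v z - v z') ≤ ‖z - z'‖ * ‖v z - v z'‖ :=
        (le_abs_self _).trans ((z - z').le_opNorm _)
      simp only [sub_apply, map_sub] at h3
      rcases (norm_nonneg (v z - v z')).eq_or_lt with h0 | h0
      · rw [← h0]; exact norm_nonneg _
      · refine le_of_mul_le_mul_right ?_ h0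
        nlinarith
    exact this.continuous
  · intro lam hlam δ n x hx
    set Z : ℕ → E →L[ℝ] ℝ := fun i => lam⁻¹ • ∑ j ∈ Finset.range i, δ j with hZ
    have hV : ∀ m : ℕ, Z m (v (Z m)) - d (v (Z m)) ≤
        ∑ i ∈ Finset.range m, (lam⁻¹ * δ i (v (Z i)) + 1 / 2 * (lam⁻¹ * ‖δ i‖) ^ 2) := by
      intro m
      induction m with
      | zero =>
        have : Z 0 = 0 := by simp [hZ]
        rw [this]
        have := (hd0 _ (hvK 0)).1
        simp; exact this
      | succ m ih =>
        rw [Finset.sum_range_succ]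
        have e : Z (m + 1) = Z m + lam⁻¹ • δ m := by
          simp only [hZ]; rw [Finset.sum_range_succ, smul_add]
        have h1 := hstr (Z m) (v (Z (m + 1))) (hvK _)
        have h2 : Z (m + 1) (v (Z (m+1))) = Z m (v (Z (m+1))) + lam⁻¹ * δ m (v (Z m))
            + lam⁻¹ * δ m (v (Z (m+1)) - v (Z m)) := by
          have e4 : ∀ y : E, Z (m + 1) y = Z m y + lam⁻¹ * δ m y := fun y => by
            rw [e]; simp
          rw [e4, map_sub]
          ring
        have h3 : δ m (v (Z (m+1)) - v (Z m)) ≤ ‖δ m‖ * ‖v (Z (m+1)) - v (Z m)‖ :=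
          (le_abs_self _).trans ((δ m).le_opNorm _)
        have h4 := mul_le_mul_of_nonneg_left h3 (inv_pos.2 hlam).le
        rw [h2]
        nlinarith [sq_nonneg (lam⁻¹ * ‖δ m‖ - ‖v (Z (m+1)) - v (Z m)‖)]
    have h1 := (hvm (Z n) x hx).trans (hV n)
    have h2 := (hd0 x hx).2
    have h3 : Z n x = lam⁻¹ * ∑ i ∈ Finset.range n, δ i x := by
      simp [hZ]
    rw [h3] at h1
    have h4 : lam⁻¹ * ∑ i ∈ Finset.range n, δ i x ≤ Om +
        ∑ i ∈ Finset.range n, (lam⁻¹ * δ i (v (Z i)) + 1 / 2 * (lam⁻¹ * ‖δ i‖) ^ 2) := by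
      linarith
    have h5 := mul_le_mul_of_nonneg_left h4 hlam.le
    rw [mul_inv_cancel_left₀ hlam.ne', mul_add, Finset.mul_sum] at h5
    refine h5.trans (le_of_eq ?_)
    rw [add_assoc, Finset.mul_sum, ← Finset.sum_add_distrib]
    congr 1
    refine Finset.sum_congr rfl fun i _ => ?_
    simp only [hZ]
    field_simp

end DGF

section Path

lemma prox_ereal {E : Type*} [NormedAddCommGroup E] [NormedSpace ℝ E]
    {h : E → EReal} {Dh : E → E →L[ℝ] ℝ} {K : Set E} {Om : ℝ}
    (hK : Convex ℝ K) (hh : IsDGF h Dh K)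
    (hO : (⨆ x ∈ K, ⨆ x' ∈ K ∩ interior (edom h), Dbreg h Dh x x') = (Om : EReal))
    {g : E → EReal} (hg : IsCCP g) (hgK : (edom g ∩ K).Nonempty) {b : ℝ} (hb : 0 < b)
    {xk p : E} (hxk : xk ∈ K ∩ interior (edom h)) (hp : p ∈ K ∩ interior (edom h))
    {ξ : E →L[ℝ] ℝ}
    (hmin : ∀ x ∈ K, g p + ((ξ (p - xk) : ℝ) : EReal) + (b : EReal) * Dbreg h Dh p xk
      ≤ g x + ((ξ (x - xk) : ℝ) : EReal) + (b : EReal) * Dbreg h Dh x xk) :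
    p ∈ edom g ∧ ∀ x ∈ K, x ∈ edom g → (g p).toReal - (g x).toReal + ξ (p - x) ≤
      b * (rD h Dh x xk - rD h Dh p xk - rD h Dh x p) := by
  have hc := dgf_coe hh xk hxk hO
  have hmin' : ∀ x ∈ K, x ∈ edom g → g p + ((ξ (p - xk) + b * rD h Dh p xk : ℝ) : EReal)
      ≤ (((g x).toReal + ξ (x - xk) + b * rD h Dh x xk : ℝ) : EReal) := by
    intro x hx hxg
    have h1 := hmin x hx
    have hx' : g x ≠ ⊤ := LT.lt.ne hxg
    rw [dgf_breg hc hp.1 hxk.1, dgf_breg hc hx hxk.1,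
      ← EReal.coe_toReal hx' (hg.2.2.1 x)] at h1
    rw [EReal.coe_add, ← add_assoc]
    exact_mod_cast h1
  have hpg : p ∈ edom g := by
    obtain ⟨x, hxg, hx⟩ := hgK
    have h1 := hmin' x hx hxg
    change g p < ⊤
    rw [lt_top_iff_ne_top]
    intro ht
    rw [ht, EReal.top_add_coe] at h1
    exact absurd h1 (not_le.2 (EReal.coe_lt_top _))
  refine ⟨hpg, fun x hx hxg => ?_⟩
  have hp' : g p ≠ ⊤ := LT.lt.ne hpg
  have hmin2 : ∀ x ∈ K, x ∈ edom g → (g p).toReal + ξ (p - xk) + b * rD h Dh p xk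
      ≤ (g x).toReal + ξ (x - xk) + b * rD h Dh x xk := by
    intro x hx hxg
    have h1 := hmin' x hx hxg
    rw [← EReal.coe_toReal hp' (hg.2.2.1 p)] at h1
    have : (((g p).toReal + (ξ (p - xk) + b * rD h Dh p xk) : ℝ) : EReal) ≤
       (((g x).toReal + ξ (x - xk) + b * rD h Dh x xk : ℝ) : EReal) := by exact_mod_cast h1
    have := EReal.coe_le_coe_iff.1 this
    linarith
  have hcomb : ∀ s : ℝ, p + s • (x - p) = (1 - s) • p + s • x := fun s => by module
  refine aux_prox (G := fun x => (g x).toReal) (h := fun x => (h x).toReal) (h' := Dh p)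
    (hk' := Dh xk) hb (hh.2.2.1.2.1 p hp.2) ?_ ?_
  · intro s hs hs1
    rw [hcomb]
    exact ccp_toReal_convex hg hpg hxg (by linarith) hs.le (by ring)
  · intro s hs hs1
    have m1 : p + s • (x - p) ∈ K := by
      rw [hcomb]; exact hK hp.1 hx (by linarith) hs.le (by ring)
    have m2 : p + s • (x - p) ∈ edom g := by
      rw [hcomb]; exact edom_convex hg hpg hxg (by linarith) hs.le (by ring)
    exact hmin2 _ m1 m2

lemma ycore {k Lyx Lyy A a b c e : ℝ} (hk : 0 ≤ k) (h1 : 0 ≤ Lyx) (h2 : 0 ≤ Lyy) (hA : 0 < A) :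
    k * ((Lyx * a + Lyy * b + e) * c) ≤ (k * (Lyx + Lyy) / 2 + 8 * k * A * √k) * c ^ 2
      + Lyx * k / 2 * a ^ 2 + Lyy * k / 2 * b ^ 2 + √k / (32 * A) * e ^ 2 := by
  have hq := Real.sqrt_nonneg k
  have hqk := Real.sq_sqrt hk
  set q := √k
  have e1 : q / (32 * A) * (16 * q * A * c - e) ^ 2 =
      8 * k * A * q * c ^ 2 - k * (e * c) + q / (32 * A) * e ^ 2 := by
    rw [← hqk]; field_simp; ring
  have e2 : 0 ≤ q / (32 * A) * (16 * q * A * c - e) ^ 2 := by positivity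
  have e3 : 0 ≤ k * Lyx / 2 * (a - c) ^ 2 := by positivity
  have e4 : 0 ≤ k * Lyy / 2 * (b - c) ^ 2 := by positivity
  nlinarith

lemma xcore {t B d c : ℝ} (ht : 0 ≤ t) (hB : 0 < B) :
    t * (d * c) ≤ B * t * √t * c ^ 2 + √t / (4 * B) * d ^ 2 := by
  have hq := Real.sqrt_nonneg t
  have hqk := Real.sq_sqrt ht
  set q := √t
  have e1 : q / (4 * B) * (2 * B * q * c - d) ^ 2 =
      B * t * q * c ^ 2 - t * (d * c) + q / (4 * B) * d ^ 2 := by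
    rw [← hqk]; field_simp; ring
  have e2 : 0 ≤ q / (4 * B) * (2 * B * q * c - d) ^ 2 := by positivity
  linarith

/-- Weighted inverse step sizes. -/
noncomputable def cXf (L M B : ℝ) (t : ℝ) : ℝ := 4 * L + 2 * M * t + 2 * B * (t * √t)
noncomputable def cYf (M A : ℝ) (t : ℝ) : ℝ := 16 * M * t + 16 * A * (t * √t)

lemma mul_sqrt_mono {k t : ℝ} (hk : 0 ≤ k) (h : k ≤ t) : k * √k ≤ t * √t :=
  mul_le_mul h (Real.sqrt_le_sqrt h) (Real.sqrt_nonneg _) (hk.trans h)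

/-- Scalar inequality behind one step of the potential argument. -/
lemma step_scalar {k L Lxx Lyx Lyy A B Q Q' Ox Oy Dx Dx' Dxx Dy Dy' Dyy nx ny nx0 ny0 dx e qn qo
    Nx Ny E rx ry : ℝ}
    (hk : 0 ≤ k) (hL : 0 ≤ L) (hLxx : 0 ≤ Lxx) (hLyx : 0 ≤ Lyx) (hLyy : 0 ≤ Lyy)
    (hA : 0 < A) (hB : 0 < B)
    (hDx : Dx ≤ Ox) (hDy : Dy ≤ Oy)
    (hDxx : 1 / 2 * nx ^ 2 ≤ Dxx) (hDyy : 1 / 2 * ny ^ 2 ≤ Dyy)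
    (hQ : (k + 2) / 2 * Q' ≤ k / 2 * Q + E)
    (hE : (k + 1) * E ≤ cXf L (Lxx + Lyx) B (k + 1) * (Dx - Dx' - Dxx)
      + cYf (Lyx + Lyy) A (k + 1) * (Dy - Dy' - Dyy)
      + (k + 1) * ((L / (k + 2) + Lxx / 2) * nx ^ 2) + (k + 1) * Nx + (k + 1) * rx
      + (k + 1) * qn - k * qo + k * ry - (k + 1) * Ny)
    (hrx : rx ≤ dx * nx) (hry : ry ≤ (Lyx * nx0 + Lyy * ny0 + e) * ny) :
    (k + 1) * (k + 2) / 2 * Q' - cXf L (Lxx + Lyx) B (k + 1) * (Ox - Dx')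
      - cYf (Lyx + Lyy) A (k + 1) * (Oy - Dy') - (k + 1) * qn
      + Lyx * (k + 1) / 2 * nx ^ 2 + Lyy * (k + 1) / 2 * ny ^ 2
    ≤ (k * (k + 1) / 2 * Q - cXf L (Lxx + Lyx) B k * (Ox - Dx)
      - cYf (Lyx + Lyy) A k * (Oy - Dy) - k * qo
      + Lyx * k / 2 * nx0 ^ 2 + Lyy * k / 2 * ny0 ^ 2)
      + ((k + 1) * Nx + √(k + 1) / (4 * B) * dx ^ 2 - (k + 1) * Ny
        + √k / (32 * A) * e ^ 2) := by
  have hk1 : 0 ≤ k + 1 := by linarith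
  have hms := mul_sqrt_mono hk (by linarith : k ≤ k + 1)
  have hx := xcore (d := dx) (c := nx) hk1 hB
  have hy := ycore (a := nx0) (b := ny0) (c := ny) (e := e) hk hLyx hLyy hA
  have mx : cXf L (Lxx + Lyx) B k ≤ cXf L (Lxx + Lyx) B (k + 1) := by
    unfold cXf; linarith [mul_nonneg hB.le (sub_nonneg.2 hms)]
  have my : cYf (Lyx + Lyy) A k ≤ cYf (Lyx + Lyy) A (k + 1) := by
    unfold cYf; linarith [mul_nonneg hA.le (sub_nonneg.2 hms)]
  have px : 0 ≤ cXf L (Lxx + Lyx) B (k + 1) := by unfold cXf; positivity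
  have py : 0 ≤ cYf (Lyx + Lyy) A (k + 1) := by unfold cYf; positivity
  have a1 := mul_le_mul_of_nonneg_right mx (sub_nonneg.2 hDx)
  have a2 := mul_le_mul_of_nonneg_right my (sub_nonneg.2 hDy)
  have a3 := mul_le_mul_of_nonneg_left hDxx px
  have a4 := mul_le_mul_of_nonneg_left hDyy py
  have a5 := mul_le_mul_of_nonneg_left hQ hk1
  have a6 := mul_le_mul_of_nonneg_left hrx hk1
  have a7 := mul_le_mul_of_nonneg_left hry hk
  have b1 : (k + 1) * ((L / (k + 2) + Lxx / 2) * nx ^ 2) ≤ (L + (k + 1) * Lxx / 2) * nx ^ 2 := by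
    have : (k + 1) * (L / (k + 2)) ≤ L := by
      rw [← mul_div_assoc, div_le_iff₀ (by linarith)]
      linarith
    linarith [mul_le_mul_of_nonneg_right this (sq_nonneg nx)]
  have b2 : (L + (k + 1) * Lxx / 2) * nx ^ 2 + B * (k + 1) * √(k + 1) * nx ^ 2
      + Lyx * (k + 1) / 2 * nx ^ 2 ≤ cXf L (Lxx + Lyx) B (k + 1) * (1 / 2 * nx ^ 2) := by
    have : 0 ≤ (L + (k + 1) * Lxx / 2 + Lyx * (k + 1) / 2) * nx ^ 2 := by positivity
    unfold cXf
    linarith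
  have b3 : (k * (Lyx + Lyy) / 2 + 8 * k * A * √k) * ny ^ 2 + Lyy * (k + 1) / 2 * ny ^ 2
      ≤ cYf (Lyx + Lyy) A (k + 1) * (1 / 2 * ny ^ 2) := by
    have c1 : 0 ≤ A * ((k + 1) * √(k + 1) - k * √k) * ny ^ 2 :=
      mul_nonneg (mul_nonneg hA.le (sub_nonneg.2 hms)) (sq_nonneg _)
    have c2 : 0 ≤ (k * (Lyx + Lyy) * 7 + Lyx * 8 + Lyy * (15 / 2)) * ny ^ 2 := by positivity
    have c3 : 0 ≤ (k * (Lyx + Lyy)) * ny ^ 2 := by positivity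
    have c4 : 0 ≤ (k * Lyx) * ny ^ 2 := by positivity
    have c5 : 0 ≤ (k * Lyy) * ny ^ 2 := by positivity
    unfold cYf
    linarith
  linarith

end Path

section Path2

variable {𝕏 𝕐 : Type*} [NormedAddCommGroup 𝕏] [NormedSpace ℝ 𝕏]
  [NormedAddCommGroup 𝕐] [NormedSpace ℝ 𝕐]

/-- Real-valued saddle-point gap at a pair of test points. -/
noncomputable def rQ (f : 𝕏 → ℝ) (g : 𝕏 → EReal) (Φ : 𝕏 → 𝕐 → ℝ) (J : 𝕐 → EReal)
    (xb : 𝕏) (yb : 𝕐) (x : 𝕏) (y : 𝕐) : ℝ :=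
  (f xb + (g xb).toReal + Φ xb y - (J y).toReal)
    - (f x + (g x).toReal + Φ x yb - (J yb).toReal)

lemma clm_le {E : Type*} [NormedAddCommGroup E] [NormedSpace ℝ E] (z : E →L[ℝ] ℝ) (v : E) :
    z v ≤ ‖z‖ * ‖v‖ := (le_abs_self _).trans (z.le_opNorm v)

/-- One-step recursion of the gap. -/
lemma step_gap {X : Set 𝕏} {Y : Set 𝕐} (hXconv : Convex ℝ X) (hYconv : Convex ℝ Y)
    {L Lxx : ℝ}
    {f : 𝕏 → ℝ} {Df : 𝕏 → 𝕏 →L[ℝ] ℝ}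
    (hf_cvx : ConvexOn ℝ X f)
    (hf_deriv : ∀ x ∈ X, HasFDerivAt f (Df x) x)
    (hf_smooth : ∀ x ∈ X, ∀ x' ∈ X, ‖Df x - Df x'‖ ≤ L * ‖x - x'‖)
    {g : 𝕏 → EReal} {J : 𝕐 → EReal}
    {Φ : 𝕏 → 𝕐 → ℝ}
    {DxΦ : 𝕏 → 𝕐 → 𝕏 →L[ℝ] ℝ} {DyΦ : 𝕏 → 𝕐 → 𝕐 →L[ℝ] ℝ}
    (hΦcvx : ∀ y ∈ Y, ConvexOn ℝ X (fun x => Φ x y))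
    (hΦccv : ∀ x ∈ X, ConcaveOn ℝ Y (Φ x))
    (hΦdx : ∀ x ∈ X, ∀ y ∈ Y, HasFDerivAt (fun x' => Φ x' y) (DxΦ x y) x)
    (hΦdy : ∀ x ∈ X, ∀ y ∈ Y, HasFDerivAt (fun y' => Φ x y') (DyΦ x y) y)
    (hΦxx : ∀ x ∈ X, ∀ x' ∈ X, ∀ y ∈ Y, ‖DxΦ x y - DxΦ x' y‖ ≤ Lxx * ‖x - x'‖)
    {b : ℝ} (hb0 : 0 ≤ b) (hb1 : b ≤ 1)
    {x xk xp xb xt xbp : 𝕏} {y yp yb ybp : 𝕐}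
    (hx : x ∈ X) (hxk : xk ∈ X) (hxp : xp ∈ X) (hxb : xb ∈ X)
    (hy : y ∈ Y) (hyp : yp ∈ Y) (hyb : yb ∈ Y)
    (ht : xt = (1 - b) • xb + b • xk) (hbp : xbp = (1 - b) • xb + b • xp)
    (hybp : ybp = (1 - b) • yb + b • yp)
    (hgc : (g xbp).toReal ≤ (1 - b) * (g xb).toReal + b * (g xp).toReal)
    (hJc : (J ybp).toReal ≤ (1 - b) * (J yb).toReal + b * (J yp).toReal) :
    rQ f g Φ J xbp ybp x y ≤ (1 - b) * rQ f g Φ J xb yb x y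
      + b * (Df xt (xp - x) + L * b / 2 * ‖xp - xk‖ ^ 2 + (g xp).toReal - (g x).toReal
        + DyΦ xp yp (y - yp) + DxΦ xk yp (xp - x) + Lxx / 2 * ‖xp - xk‖ ^ 2
        + (J yp).toReal - (J y).toReal) := by
  have h1 := aux_f_part hXconv hf_cvx hf_deriv hf_smooth hb0 hb1 hxb hxk hxp hx ht hbp
  have h2 : Φ xbp y ≤ (1 - b) * Φ xb y + b * Φ xp y := by
    have := (hΦcvx y hy).2 hxb hxp (by linarith : 0 ≤ 1 - b) hb0 (by ring)
    rw [← hbp] at this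
    simpa using this
  have h3 : (1 - b) * Φ x yb + b * Φ x yp ≤ Φ x ybp := by
    have := (hΦccv x hx).2 hyb hyp (by linarith : 0 ≤ 1 - b) hb0 (by ring)
    rw [← hybp] at this
    simpa using this
  have h4 : Φ xp y ≤ Φ xp yp + DyΦ xp yp (y - yp) := by
    have := aux_grad_ineq (f := fun y' => - Φ xp y') (hΦccv xp hxp).neg hyp hy
      (hΦdy xp hxp yp hyp).neg
    simp only [neg_apply] at this
    linarith
  have h5 := aux_grad_ineq (hΦcvx yp hyp) hxk hx (hΦdx xk hxk yp hyp)
  have h6 := aux_descent (f := fun x' => Φ x' yp) (Df := fun x' => DxΦ x' yp) hXconv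
    (fun x hx => hΦdx x hx yp hyp) (fun x hx x' hx' => hΦxx x hx x' hx' yp hyp) hxk hxp
  have h7 : DxΦ xk yp (xp - x) = DxΦ xk yp (xp - xk) - DxΦ xk yp (x - xk) := by
    rw [← map_sub]; congr 1; abel
  beta_reduce at h5 h6
  have h8 : Φ xp y - Φ x yp ≤ DyΦ xp yp (y - yp) + DxΦ xk yp (xp - x)
      + Lxx / 2 * ‖xp - xk‖ ^ 2 := by linarith
  have h9 := mul_le_mul_of_nonneg_left h8 hb0
  unfold rQ
  linarith

lemma path_bound
    (X : Set 𝕏) (Y : Set 𝕐)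
    (hXconv : Convex ℝ X) (hYconv : Convex ℝ Y)
    (L Lxx Lyx Lyy : ℝ) (hL : 0 ≤ L) (hLxx : 0 ≤ Lxx) (hLyx : 0 ≤ Lyx) (hLyy : 0 ≤ Lyy)
    (f : 𝕏 → ℝ) (Df : 𝕏 → 𝕏 →L[ℝ] ℝ)
    (hf_cvx : ConvexOn ℝ X f)
    (hf_deriv : ∀ x ∈ X, HasFDerivAt f (Df x) x)
    (hf_smooth : ∀ x ∈ X, ∀ x' ∈ X, ‖Df x - Df x'‖ ≤ L * ‖x - x'‖)
    (g : 𝕏 → EReal) (hg : IsCCP g) (hgX : (edom g ∩ X).Nonempty)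
    (J : 𝕐 → EReal) (hJ : IsCCP J) (hJY : (edom J ∩ Y).Nonempty)
    (Φ : 𝕏 → 𝕐 → ℝ)
    (DxΦ : 𝕏 → 𝕐 → 𝕏 →L[ℝ] ℝ) (DyΦ : 𝕏 → 𝕐 → 𝕐 →L[ℝ] ℝ)
    (hΦcvx : ∀ y ∈ Y, ConvexOn ℝ X (fun x => Φ x y))
    (hΦccv : ∀ x ∈ X, ConcaveOn ℝ Y (Φ x))
    (hΦdx : ∀ x ∈ X, ∀ y ∈ Y, HasFDerivAt (fun x' => Φ x' y) (DxΦ x y) x)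
    (hΦdy : ∀ x ∈ X, ∀ y ∈ Y, HasFDerivAt (fun y' => Φ x y') (DyΦ x y) y)
    (hΦxx : ∀ x ∈ X, ∀ x' ∈ X, ∀ y ∈ Y, ‖DxΦ x y - DxΦ x' y‖ ≤ Lxx * ‖x - x'‖)
    (hΦyx2 : ∀ x ∈ X, ∀ x' ∈ X, ∀ y ∈ Y, ‖DyΦ x y - DyΦ x' y‖ ≤ Lyx * ‖x - x'‖)
    (hΦyy : ∀ x ∈ X, ∀ y ∈ Y, ∀ y' ∈ Y, ‖DyΦ x y - DyΦ x y'‖ ≤ Lyy * ‖y - y'‖)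
    (dgfX : 𝕏 → EReal) (DdgfX : 𝕏 → 𝕏 →L[ℝ] ℝ) (hdgfX : IsDGF dgfX DdgfX X)
    (dgfY : 𝕐 → EReal) (DdgfY : 𝕐 → 𝕐 →L[ℝ] ℝ) (hdgfY : IsDGF dgfY DdgfY Y)
    (ΩX ΩY : ℝ)
    (hΩX : (⨆ x ∈ X, ⨆ x' ∈ X ∩ interior (edom dgfX), Dbreg dgfX DdgfX x x')
      = (ΩX : EReal))
    (hΩY : (⨆ y ∈ Y, ⨆ y' ∈ Y ∩ interior (edom dgfY), Dbreg dgfY DdgfY y y')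
      = (ΩY : EReal))
    (θ β α τ : ℕ → ℝ)
    (xs xb xt : ℕ → 𝕏) (ys yb : ℕ → 𝕐)
    (s : ℕ → 𝕐 →L[ℝ] ℝ)
    (Gf GxΦ : ℕ → 𝕏 →L[ℝ] ℝ) (GyΦ : ℕ → 𝕐 →L[ℝ] ℝ)
    (hinit_x : xs 1 ∈ X ∩ interior (edom dgfX))
    (hinit_y : ys 1 ∈ Y ∩ interior (edom dgfY))
    (hinit_xb : xb 1 = xs 1) (hinit_yb : yb 1 = ys 1) (hinit_s : s 1 = GyΦ 1)
    (hstep_y : ∀ t, 1 ≤ t → ys (t+1) ∈ Y ∩ interior (edom dgfY) ∧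
      ∀ y ∈ Y,
        J (ys (t+1)) + ((-((s t) (ys (t+1) - ys t)) : ℝ) : EReal)
            + (((α t)⁻¹ : ℝ) : EReal) * Dbreg dgfY DdgfY (ys (t+1)) (ys t)
          ≤ J y + ((-((s t) (y - ys t)) : ℝ) : EReal)
            + (((α t)⁻¹ : ℝ) : EReal) * Dbreg dgfY DdgfY y (ys t))
    (hstep_xt : ∀ t, 1 ≤ t → xt (t+1) = (1 - β t) • xb t + β t • xs t)
    (hstep_x : ∀ t, 1 ≤ t → xs (t+1) ∈ X ∩ interior (edom dgfX) ∧
      ∀ x ∈ X,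
        g (xs (t+1)) + (((GxΦ t + Gf t) (xs (t+1) - xs t) : ℝ) : EReal)
            + (((τ t)⁻¹ : ℝ) : EReal) * Dbreg dgfX DdgfX (xs (t+1)) (xs t)
          ≤ g x + (((GxΦ t + Gf t) (x - xs t) : ℝ) : EReal)
            + (((τ t)⁻¹ : ℝ) : EReal) * Dbreg dgfX DdgfX x (xs t))
    (hstep_s : ∀ t, 1 ≤ t →
      s (t+1) = (1 + θ (t+1)) • GyΦ (t+1) - θ (t+1) • GyΦ t)
    (hstep_xb : ∀ t, 1 ≤ t → xb (t+1) = (1 - β t) • xb t + β t • xs (t+1))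
    (hstep_yb : ∀ t, 1 ≤ t → yb (t+1) = (1 - β t) • yb t + β t • ys (t+1))
    (δy : ℕ → 𝕐 →L[ℝ] ℝ) (δx : ℕ → 𝕏 →L[ℝ] ℝ)
    (hδy : ∀ t, δy t = GyΦ t - DyΦ (xs t) (ys t))
    (hδx : ∀ t, δx t = (GxΦ t - DxΦ (xs t) (ys (t+1))) + (Gf t - Df (xt (t+1))))
    (A B : ℝ) (hA : 0 < A) (hB : 0 < B)
    (hθ : ∀ t : ℕ, 1 ≤ t → θ t = ((t : ℝ) - 1) / t)
    (hβ : ∀ t : ℕ, 1 ≤ t → β t = 2 / ((t : ℝ) + 1))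
    (hα : ∀ t : ℕ, 1 ≤ t → t * (α t)⁻¹ = cYf (Lyx + Lyy) A t ∧ 0 < (α t)⁻¹)
    (hτ : ∀ t : ℕ, 1 ≤ t → t * (τ t)⁻¹ = cXf L (Lxx + Lyx) B t ∧ 0 < (τ t)⁻¹) :
    (∀ n : ℕ, 1 ≤ n → xb (n + 1) ∈ X ∩ edom g ∧ yb (n + 1) ∈ Y ∩ edom J) ∧
    ∀ n : ℕ, ∀ x ∈ X, x ∈ edom g → ∀ y ∈ Y, y ∈ edom J →
      (n : ℝ) * (n + 1) / 2 * rQ f g Φ J (xb (n + 1)) (yb (n + 1)) x y ≤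
        cXf L (Lxx + Lyx) B n * ΩX + cYf (Lyx + Lyy) A n * ΩY
        + ∑ k ∈ Finset.range n, (((k : ℝ) + 1) * δx (k + 1) (x - xs (k + 1))
          + √((k : ℝ) + 1) / (4 * B) * ‖δx (k + 1)‖ ^ 2
          - ((k : ℝ) + 1) * δy (k + 2) (y - ys (k + 2))
          + √(k : ℝ) / (32 * A) * ‖δy (k + 1) - δy k‖ ^ 2)
        + √(n : ℝ) / (32 * A) * ‖δy (n + 1) - δy n‖ ^ 2 := by
  have hxs : ∀ k : ℕ, xs (k + 1) ∈ X ∩ interior (edom dgfX) := by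
    intro k
    rcases k with _ | k
    · exact hinit_x
    · exact (hstep_x (k + 1) (by omega)).1
  have hys : ∀ k : ℕ, ys (k + 1) ∈ Y ∩ interior (edom dgfY) := by
    intro k
    rcases k with _ | k
    · exact hinit_y
    · exact (hstep_y (k + 1) (by omega)).1
  have hcX := dgf_coe hdgfX _ hinit_x hΩX
  have hcY := dgf_coe hdgfY _ hinit_y hΩY
  have hpx : ∀ k : ℕ, _ := fun k => prox_ereal hXconv hdgfX hΩX hg hgX
    (hτ (k + 1) (by omega)).2 (hxs k) (hxs (k + 1)) (hstep_x (k + 1) (by omega)).2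
  have hpy : ∀ k : ℕ, _ := fun k => prox_ereal (ξ := - s (k + 1)) hYconv hdgfY hΩY hJ hJY
    (hα (k + 1) (by omega)).2 (hys k) (hys (k + 1)) (hstep_y (k + 1) (by omega)).2
  have hβk : ∀ k : ℕ, β (k + 1) = 2 / ((k : ℝ) + 2) := fun k => by
    rw [hβ (k + 1) (by omega)]; push_cast; ring_nf
  have hβ01 : ∀ k : ℕ, 0 ≤ β (k + 1) ∧ β (k + 1) ≤ 1 := fun k => by
    rw [hβk]
    refine ⟨by positivity, ?_⟩
    rw [div_le_one (by positivity)]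
    have : (0:ℝ) ≤ k := by positivity
    linarith
  have hβ1 : β 1 = 1 := by rw [hβ 1 le_rfl]; norm_num
  have hxb1 : xb 2 = xs 2 := by
    rw [hstep_xb 1 le_rfl, hβ1]; simp
  have hyb1 : yb 2 = ys 2 := by
    rw [hstep_yb 1 le_rfl, hβ1]; simp
  have hxbX : ∀ k : ℕ, xb (k + 1) ∈ X ∧ yb (k + 1) ∈ Y := by
    intro k
    induction k with
    | zero => rw [zero_add, hinit_xb, hinit_yb]; exact ⟨hinit_x.1, hinit_y.1⟩
    | succ k ih =>
      have hb := hβ01 k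
      rw [hstep_xb (k + 1) (by omega), hstep_yb (k + 1) (by omega)]
      exact ⟨hXconv ih.1 (hxs (k + 1)).1 (by linarith) hb.1 (by ring),
        hYconv ih.2 (hys (k + 1)).1 (by linarith) hb.1 (by ring)⟩
  have hdom : ∀ k : ℕ, xb (k + 2) ∈ edom g ∧ yb (k + 2) ∈ edom J := by
    intro k
    induction k with
    | zero =>
      rw [zero_add, hxb1, hyb1]
      exact ⟨(hpx 0).1, (hpy 0).1⟩
    | succ k ih =>
      have hb := hβ01 (k + 1)
      rw [hstep_xb (k + 2) (by omega), hstep_yb (k + 2) (by omega)]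
      exact ⟨edom_convex hg ih.1 (hpx (k + 1)).1 (by linarith) hb.1 (by ring),
        edom_convex hJ ih.2 (hpy (k + 1)).1 (by linarith) hb.1 (by ring)⟩
  have hgc : ∀ k : ℕ, (g (xb (k + 2))).toReal ≤ (1 - β (k + 1)) * (g (xb (k + 1))).toReal
      + β (k + 1) * (g (xs (k + 2))).toReal := by
    intro k
    rcases k with _ | k
    · simp [hxb1, hβ1]
    · have hb := hβ01 (k + 1)
      rw [hstep_xb (k + 2) (by omega)]
      exact ccp_toReal_convex hg (hdom k).1 (hpx (k + 1)).1 (by linarith) hb.1 (by ring)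
  have hJc : ∀ k : ℕ, (J (yb (k + 2))).toReal ≤ (1 - β (k + 1)) * (J (yb (k + 1))).toReal
      + β (k + 1) * (J (ys (k + 2))).toReal := by
    intro k
    rcases k with _ | k
    · simp [hyb1, hβ1]
    · have hb := hβ01 (k + 1)
      rw [hstep_yb (k + 2) (by omega)]
      exact ccp_toReal_convex hJ (hdom k).2 (hpy (k + 1)).1 (by linarith) hb.1 (by ring)
  -- s
  have hs : ∀ k : ℕ, ((k : ℝ) + 1) • s (k + 1)
      = ((k : ℝ) + 1) • GyΦ (k + 1) + (k : ℝ) • (GyΦ (k + 1) - GyΦ k) := by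
    intro k
    rcases k with _ | k
    · simp [hinit_s]
    · rw [hstep_s (k + 1) (by omega), hθ (k + 1 + 1) (by omega)]
      push_cast
      have hne : ((k : ℝ) + 1 + 1) ≠ 0 := by positivity
      rw [smul_sub, smul_smul, smul_smul]
      have e1 : ((k : ℝ) + 1 + 1) * (1 + ((k : ℝ) + 1 + 1 - 1) / ((k : ℝ) + 1 + 1))
          = ((k : ℝ) + 1 + 1) + (k + 1) := by field_simp; ring
      have e2 : ((k : ℝ) + 1 + 1) * (((k : ℝ) + 1 + 1 - 1) / ((k : ℝ) + 1 + 1)) = k + 1 := by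
        field_simp; ring
      rw [e1, e2]
      module
  -- bound on the gradient difference
  have hq : ∀ k : ℕ, ∀ c : ℝ, 0 ≤ c → (k : ℝ) * (‖GyΦ (k + 1) - GyΦ k‖ * c) ≤
      k * ((Lyx * ‖xs (k + 1) - xs k‖ + Lyy * ‖ys (k + 1) - ys k‖
        + ‖δy (k + 1) - δy k‖) * c) := by
    intro k c hc
    rcases k with _ | k
    · simp
    · refine mul_le_mul_of_nonneg_left (mul_le_mul_of_nonneg_right ?_ hc) (by positivity)
      have e : GyΦ (k + 1 + 1) - GyΦ (k + 1) =
          (DyΦ (xs (k + 1 + 1)) (ys (k + 1 + 1)) - DyΦ (xs (k + 1)) (ys (k + 1 + 1)))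
          + (DyΦ (xs (k + 1)) (ys (k + 1 + 1)) - DyΦ (xs (k + 1)) (ys (k + 1)))
          + (δy (k + 1 + 1) - δy (k + 1)) := by
        rw [hδy, hδy]; abel
      rw [e]
      refine (norm_add₃_le).trans ?_
      have a1 := hΦyx2 _ (hxs (k + 1)).1 _ (hxs k).1 _ (hys (k + 1)).1
      have a2 := hΦyy _ (hxs k).1 _ (hys (k + 1)).1 _ (hys k).1
      linarith
  refine ⟨fun n hn => ?_, ?_⟩
  · obtain ⟨k, rfl⟩ : ∃ k, n = k + 1 := ⟨n - 1, by omega⟩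
    exact ⟨⟨(hxbX (k + 1)).1, (hdom k).1⟩, ⟨(hxbX (k + 1)).2, (hdom k).2⟩⟩
  intro n x hx hxg y hy hyJ
  have hOx : ∀ k : ℕ, rD dgfX DdgfX x (xs (k + 1)) ≤ ΩX :=
    fun k => (dgf_bounds hdgfX hΩX hcX hx (hxs k)).2
  have hOy : ∀ k : ℕ, rD dgfY DdgfY y (ys (k + 1)) ≤ ΩY :=
    fun k => (dgf_bounds hdgfY hΩY hcY hy (hys k)).2
  have main : ∀ n : ℕ,
      (n : ℝ) * (n + 1) / 2 * rQ f g Φ J (xb (n + 1)) (yb (n + 1)) x y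
      - cXf L (Lxx + Lyx) B n * (ΩX - rD dgfX DdgfX x (xs (n + 1)))
      - cYf (Lyx + Lyy) A n * (ΩY - rD dgfY DdgfY y (ys (n + 1)))
      - n * (GyΦ (n + 1) - GyΦ n) (y - ys (n + 1))
      + Lyx * n / 2 * ‖xs (n + 1) - xs n‖ ^ 2 + Lyy * n / 2 * ‖ys (n + 1) - ys n‖ ^ 2
      ≤ ∑ k ∈ Finset.range n, (((k : ℝ) + 1) * δx (k + 1) (x - xs (k + 1))
          + √((k : ℝ) + 1) / (4 * B) * ‖δx (k + 1)‖ ^ 2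
          - ((k : ℝ) + 1) * δy (k + 2) (y - ys (k + 2))
          + √(k : ℝ) / (32 * A) * ‖δy (k + 1) - δy k‖ ^ 2) := by
    intro n
    induction n with
    | zero =>
      have a1 : 0 ≤ cXf L (Lxx + Lyx) B 0 * (ΩX - rD dgfX DdgfX x (xs 1)) := by
        refine mul_nonneg ?_ (sub_nonneg.2 (hOx 0))
        unfold cXf; simp; exact hL
      have a2 : cYf (Lyx + Lyy) A 0 = 0 := by unfold cYf; simp
      simp [a2]
      exact a1
    | succ k ih =>
      rw [Finset.sum_range_succ]
      refine le_trans ?_ (add_le_add_left ih _)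
      have hgap := step_gap (g := g) (J := J) hXconv hYconv hf_cvx hf_deriv hf_smooth hΦcvx hΦccv
        hΦdx hΦdy hΦxx
        (hβ01 k).1 (hβ01 k).2 hx (hxs k).1 (hxs (k + 1)).1 (hxbX k).1 hy (hys (k + 1)).1 (hxbX k).2
        (hstep_xt (k + 1) (by omega)) (hstep_xb (k + 1) (by omega))
        (hstep_yb (k + 1) (by omega)) (hgc k) (hJc k)
      have px := (hpx k).2 x hx hxg
      have py := (hpy k).2 y hy hyJ
      have hk2 : (0:ℝ) < (k : ℝ) + 2 := by positivity
      have hk0 : (0:ℝ) ≤ (k : ℝ) := by positivity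
      set E := Df (xt (k + 1 + 1)) (xs (k + 1 + 1) - x)
        + L * β (k + 1) / 2 * ‖xs (k + 1 + 1) - xs (k + 1)‖ ^ 2
        + (g (xs (k + 1 + 1))).toReal - (g x).toReal
        + DyΦ (xs (k + 1 + 1)) (ys (k + 1 + 1)) (y - ys (k + 1 + 1))
        + DxΦ (xs (k + 1)) (ys (k + 1 + 1)) (xs (k + 1 + 1) - x)
        + Lxx / 2 * ‖xs (k + 1 + 1) - xs (k + 1)‖ ^ 2
        + (J (ys (k + 1 + 1))).toReal - (J y).toReal with hE
      have hτk := (hτ (k + 1) (by omega)).1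
      have hαk := (hα (k + 1) (by omega)).1
      push_cast at hτk hαk ⊢
      have hfin := step_scalar (k := (k : ℝ)) (L := L) (Lxx := Lxx) (Lyx := Lyx) (Lyy := Lyy)
        (A := A) (B := B)
        (Q := rQ f g Φ J (xb (k + 1)) (yb (k + 1)) x y)
        (Q' := rQ f g Φ J (xb (k + 1 + 1)) (yb (k + 1 + 1)) x y)
        (Ox := ΩX) (Oy := ΩY)
        (Dx := rD dgfX DdgfX x (xs (k + 1))) (Dx' := rD dgfX DdgfX x (xs (k + 1 + 1)))
        (Dxx := rD dgfX DdgfX (xs (k + 1 + 1)) (xs (k + 1)))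
        (Dy := rD dgfY DdgfY y (ys (k + 1))) (Dy' := rD dgfY DdgfY y (ys (k + 1 + 1)))
        (Dyy := rD dgfY DdgfY (ys (k + 1 + 1)) (ys (k + 1)))
        (nx := ‖xs (k + 1 + 1) - xs (k + 1)‖) (ny := ‖ys (k + 1 + 1) - ys (k + 1)‖)
        (nx0 := ‖xs (k + 1) - xs k‖) (ny0 := ‖ys (k + 1) - ys k‖)
        (dx := ‖δx (k + 1)‖) (e := ‖δy (k + 1) - δy k‖)
        (qn := (GyΦ (k + 1 + 1) - GyΦ (k + 1)) (y - ys (k + 1 + 1)))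
        (qo := (GyΦ (k + 1) - GyΦ k) (y - ys (k + 1)))
        (Nx := δx (k + 1) (x - xs (k + 1))) (Ny := δy (k + 2) (y - ys (k + 2)))
        (E := E) (rx := δx (k + 1) (xs (k + 1) - xs (k + 1 + 1)))
        (ry := if k = 0 then 0 else (GyΦ (k + 1) - GyΦ k) (ys (k + 1 + 1) - ys (k + 1)))
        hk0 hL hLxx hLyx hLyy hA hB (hOx k) (hOy k)
        (dgf_bounds hdgfX hΩX hcX (hxs (k + 1)).1 (hxs k)).1
        (dgf_bounds hdgfY hΩY hcY (hys (k + 1)).1 (hys k)).1 ?_ ?_ ?_ ?_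
      · have e3 : (k : ℝ) + 1 + 1 = k + 2 := by ring
        rw [e3]
        exact hfin
      · have := mul_le_mul_of_nonneg_left hgap (by positivity : (0:ℝ) ≤ ((k : ℝ) + 2) / 2)
        rw [hβk] at this
        have e1 : ((k : ℝ) + 2) / 2 * ((1 - 2 / ((k : ℝ) + 2)) *
            rQ f g Φ J (xb (k + 1)) (yb (k + 1)) x y + 2 / ((k : ℝ) + 2) * E)
            = k / 2 * rQ f g Φ J (xb (k + 1)) (yb (k + 1)) x y + E := by
          field_simp; ring
        have e2 : k / 2 * rQ f g Φ J (xb (k + 1)) (yb (k + 1)) x y + E =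
          ((k : ℝ) + 2) / 2 * ((1 - 2 / ((k : ℝ) + 2)) *
            rQ f g Φ J (xb (k + 1)) (yb (k + 1)) x y + 2 / ((k : ℝ) + 2) * E) := e1.symm
        rw [e2]
        exact this
      · rw [← hτk, ← hαk]
        have hk1 : (0:ℝ) ≤ (k : ℝ) + 1 := by positivity
        have px' := mul_le_mul_of_nonneg_left px hk1
        have py' := mul_le_mul_of_nonneg_left py hk1
        have hsy := congrArg (fun z : 𝕐 →L[ℝ] ℝ => z (y - ys (k + 1 + 1))) (hs k)
        simp only [smul_apply, add_apply, sub_apply, smul_eq_mul] at hsy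
        have hry : (k : ℝ) * (if k = 0 then 0 else
            (GyΦ (k + 1) - GyΦ k) (ys (k + 1 + 1) - ys (k + 1)))
            = k * (GyΦ (k + 1) - GyΦ k) (ys (k + 1 + 1) - ys (k + 1)) := by
          split_ifs with h0
          · simp [h0]
          · rfl
        rw [hry]
        have hb : L * β (k + 1) / 2 = L / ((k : ℝ) + 2) := by
          rw [hβk]; field_simp
        rw [hE, hb]
        have d1 : δx (k + 1) (x - xs (k + 1)) + δx (k + 1) (xs (k + 1) - xs (k + 1 + 1))
            = - (GxΦ (k + 1) + Gf (k + 1)) (xs (k + 1 + 1) - x)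
              + DxΦ (xs (k + 1)) (ys (k + 1 + 1)) (xs (k + 1 + 1) - x)
              + Df (xt (k + 1 + 1)) (xs (k + 1 + 1) - x) := by
          rw [← map_add, hδx]
          simp only [add_apply, sub_apply, map_sub, map_add]
          ring
        have d2 : (- s (k + 1)) (ys (k + 1 + 1) - y) = s (k + 1) (y - ys (k + 1 + 1)) := by
          simp only [neg_apply, map_sub]; ring
        have d3 : δy (k + 2) (y - ys (k + 2)) = GyΦ (k + 1 + 1) (y - ys (k + 1 + 1))
            - DyΦ (xs (k + 1 + 1)) (ys (k + 1 + 1)) (y - ys (k + 1 + 1)) := by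
          rw [hδy]; rfl
        have d4 : (GyΦ (k + 1) - GyΦ k) (ys (k + 1 + 1) - ys (k + 1)) =
            (GyΦ (k + 1) - GyΦ k) (y - ys (k + 1)) -
            (GyΦ (k + 1) - GyΦ k) (y - ys (k + 1 + 1)) := by
          rw [← map_sub]; congr 1; abel
        rw [d2] at py'
        rw [d3, d4]
        have d1' := congrArg (fun r => ((k:ℝ) + 1) * r) d1
        beta_reduce at d1'
        simp only [sub_apply]
        generalize GyΦ (k + 1 + 1) (y - ys (k + 1 + 1)) = u1 at *
        generalize GyΦ (k + 1) (y - ys (k + 1 + 1)) = u2 at *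
        generalize GyΦ k (y - ys (k + 1 + 1)) = u3 at *
        linarith
      · exact clm_le _ _ |>.trans (by rw [norm_sub_rev])
      · split_ifs with h0
        · positivity
        · have hkpos : (0:ℝ) < k := by
            exact_mod_cast Nat.pos_of_ne_zero h0
          have := hq k _ (norm_nonneg (ys (k + 1 + 1) - ys (k + 1)))
          exact (clm_le _ _).trans (le_of_mul_le_mul_left this hkpos)
  have hm := main n
  have hn0 : (0:ℝ) ≤ n := by positivity
  have h1 := mul_le_mul_of_nonneg_left (clm_le (GyΦ (n + 1) - GyΦ n) (y - ys (n + 1))) hn0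
  have h2 := hq n _ (norm_nonneg (y - ys (n + 1)))
  have h3 := ycore (a := ‖xs (n + 1) - xs n‖) (b := ‖ys (n + 1) - ys n‖)
    (c := ‖y - ys (n + 1)‖) (e := ‖δy (n + 1) - δy n‖) hn0 hLyx hLyy hA
  have h4 := (dgf_bounds hdgfY hΩY hcY hy (hys n)).1
  have h5 : 0 ≤ rD dgfX DdgfX x (xs (n + 1)) :=
    le_trans (by positivity) (dgf_bounds hdgfX hΩX hcX hx (hxs n)).1
  have px : 0 ≤ cXf L (Lxx + Lyx) B n := by unfold cXf; positivity
  have py : 0 ≤ cYf (Lyx + Lyy) A n := by unfold cYf; positivity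
  have h6 := mul_nonneg px h5
  have h7 := mul_le_mul_of_nonneg_left h4 py
  have h8 : ((n:ℝ) * (Lyx + Lyy) / 2 + 8 * n * A * √(n:ℝ)) * ‖y - ys (n + 1)‖ ^ 2 ≤
      cYf (Lyx + Lyy) A n * (1 / 2 * ‖y - ys (n + 1)‖ ^ 2) := by
    have : 0 ≤ ((n:ℝ) * (Lyx + Lyy)) * ‖y - ys (n + 1)‖ ^ 2 := by positivity
    unfold cYf
    linarith
  linarith

end Path2

section Gap

variable {𝕏 𝕐 : Type*} [NormedAddCommGroup 𝕏] [NormedSpace ℝ 𝕏]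
  [NormedAddCommGroup 𝕐] [NormedSpace ℝ 𝕐]

lemma spS_coe {f : 𝕏 → ℝ} {g : 𝕏 → EReal} {Φ : 𝕏 → 𝕐 → ℝ} {J : 𝕐 → EReal}
    (hg : IsCCP g) (hJ : IsCCP J) {x : 𝕏} {y : 𝕐} (hx : x ∈ edom g) (hy : y ∈ edom J) :
    spS f g Φ J x y = ((f x + (g x).toReal + Φ x y - (J y).toReal : ℝ) : EReal) := by
  have h1 : g x = ((g x).toReal : EReal) := (EReal.coe_toReal hx.ne (hg.2.2.1 x)).symm
  have h2 : J y = ((J y).toReal : EReal) := (EReal.coe_toReal hy.ne (hJ.2.2.1 y)).symm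
  unfold spS
  rw [h1, h2]
  push_cast
  simp

/-- The duality gap is bounded by any uniform bound on the real-valued gaps. -/
lemma gap_le {X : Set 𝕏} {Y : Set 𝕐} {f : 𝕏 → ℝ} {g : 𝕏 → EReal} {Φ : 𝕏 → 𝕐 → ℝ}
    {J : 𝕐 → EReal} (hg : IsCCP g) (hJ : IsCCP J) {xb : 𝕏} {yb : 𝕐}
    (hxb : xb ∈ X ∩ edom g) (hyb : yb ∈ Y ∩ edom J) {B : ℝ}
    (hB : ∀ x ∈ X, x ∈ edom g → ∀ y ∈ Y, y ∈ edom J → rQ f g Φ J xb yb x y ≤ B) :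
    toENN (spGap X Y f g Φ J xb yb) ≤ ENNReal.ofReal B := by
  have hU : ∀ x ∈ X, x ∈ edom g → (⨆ y' ∈ Y, spS f g Φ J xb y') ≤
      ((B + (f x + (g x).toReal + Φ x yb - (J yb).toReal) : ℝ) : EReal) := by
    intro x hx hxg
    refine iSup₂_le fun y hy => ?_
    by_cases hyJ : y ∈ edom J
    · rw [spS_coe hg hJ hxb.2 hyJ, EReal.coe_le_coe_iff]
      have := hB x hx hxg y hy hyJ
      unfold rQ at this
      linarith
    · have : J y = ⊤ := by
        by_contra h
        exact hyJ (lt_top_iff_ne_top.2 h)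
      unfold spS
      rw [this, EReal.sub_top]
      exact bot_le
  have hUb : ((f xb + (g xb).toReal + Φ xb yb - (J yb).toReal : ℝ) : EReal) ≤
      (⨆ y' ∈ Y, spS f g Φ J xb y') := by
    rw [← spS_coe hg hJ hxb.2 hyb.2]
    exact le_iSup₂ (f := fun y' (_ : y' ∈ Y) => spS f g Φ J xb y') yb hyb.1
  have hIb : (⨅ x' ∈ X, spS f g Φ J x' yb) ≤
      ((f xb + (g xb).toReal + Φ xb yb - (J yb).toReal : ℝ) : EReal) := by
    rw [← spS_coe hg hJ hxb.2 hyb.2]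
    exact iInf₂_le (f := fun x' (_ : x' ∈ X) => spS f g Φ J x' yb) xb hxb.1
  unfold spGap
  generalize (⨆ y' ∈ Y, spS f g Φ J xb y') = U at *
  obtain ⟨u, rfl⟩ : ∃ u : ℝ, U = u := by
    refine ⟨U.toReal, (EReal.coe_toReal ?_ ?_).symm⟩
    · exact ((hU xb hxb.1 hxb.2).trans_lt (EReal.coe_lt_top _)).ne
    · exact ((EReal.bot_lt_coe _).trans_le hUb).ne'
  have hI : ((u - B : ℝ) : EReal) ≤ (⨅ x' ∈ X, spS f g Φ J x' yb) := by
    refine le_iInf₂ fun x hx => ?_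
    by_cases hxg : x ∈ edom g
    · rw [spS_coe hg hJ hxg hyb.2, EReal.coe_le_coe_iff]
      have := EReal.coe_le_coe_iff.1 (hU x hx hxg)
      linarith
    · have h1 : g x = ⊤ := by
        by_contra h
        exact hxg (lt_top_iff_ne_top.2 h)
      have h2 : J yb = ((J yb).toReal : EReal) :=
        (EReal.coe_toReal hyb.2.ne (hJ.2.2.1 yb)).symm
      unfold spS
      rw [h1, h2]
      simp
  generalize (⨅ x' ∈ X, spS f g Φ J x' yb) = I at *
  obtain ⟨i, rfl⟩ : ∃ i : ℝ, I = i := by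
    refine ⟨I.toReal, (EReal.coe_toReal ?_ ?_).symm⟩
    · exact (hIb.trans_lt (EReal.coe_lt_top _)).ne
    · exact ((EReal.bot_lt_coe _).trans_le hI).ne'
  have h3 := EReal.coe_le_coe_iff.1 hI
  rw [← EReal.coe_sub]
  unfold toENN
  rw [if_neg (EReal.coe_ne_top _), EReal.toReal_coe]
  exact ENNReal.ofReal_le_ofReal (by linarith)

end Gap

section Prob

variable {E : Type*} [NormedAddCommGroup E] [NormedSpace ℝ E] [FiniteDimensional ℝ E]
  {Ω : Type*} {m0 : MeasurableSpace Ω} {Pr : Measure Ω} [IsProbabilityMeasure Pr]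

/-- Unbiased noise tested against a bounded predictable direction has mean zero. -/
lemma zero_mean {m : MeasurableSpace Ω} (hm : m ≤ m0) {δ : Ω → E →L[ℝ] ℝ} {w : Ω → E}
    (hδ : Integrable δ Pr) (hz : Pr[δ | m] =ᵐ[Pr] 0) (hw : StronglyMeasurable[m] w)
    {C : ℝ} (hC : ∀ ω, ‖w ω‖ ≤ C) :
    Integrable (fun ω => δ ω (w ω)) Pr ∧ ∫ ω, δ ω (w ω) ∂Pr = 0 := by
  have hw0 : StronglyMeasurable[m0] w := hw.mono hm
  have hmeas : AEStronglyMeasurable[m0] (fun ω => δ ω (w ω)) Pr := by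
    have hc : Continuous (fun p : (E →L[ℝ] ℝ) × E => p.1 p.2) := by fun_prop
    exact hc.comp_aestronglyMeasurable (hδ.1.prodMk hw0.aestronglyMeasurable)
  have hi : Integrable (fun ω => δ ω (w ω)) Pr := by
    refine Integrable.mono' (hδ.norm.mul_const C) hmeas (Eventually.of_forall fun ω => ?_)
    exact ((δ ω).le_opNorm _).trans (mul_le_mul_of_nonneg_left (hC ω) (norm_nonneg _))
  refine ⟨hi, ?_⟩
  have h1 := condExp_bilin_of_stronglyMeasurable_right (μ := Pr)
    (ContinuousLinearMap.id ℝ (E →L[ℝ] ℝ)) hw hi hδ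
  rw [← integral_condExp hm]
  have h2 : Pr[fun ω => δ ω (w ω) | m] =ᵐ[Pr] 0 := by
    refine EventuallyEq.trans h1 ?_
    filter_upwards [hz] with ω hω
    simp [hω]
  rw [integral_congr_ae h2]
  simp

lemma zero_mean_sum (G : ℕ → MeasurableSpace Ω) (hG : ∀ i, G i ≤ m0) (hmono : Monotone G)
    (δ : ℕ → Ω → E →L[ℝ] ℝ) (w : ℕ → Ω → E)
    (hmeas : ∀ i, StronglyMeasurable[G (i + 1)] (δ i))
    (hint : ∀ i, Integrable (δ i) Pr) (hz : ∀ i, Pr[δ i | G i] =ᵐ[Pr] 0)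
    (hw : ∀ i, StronglyMeasurable[G i] (w i)) {K : Set E} {C : ℝ}
    (hC : ∀ x ∈ K, ‖x‖ ≤ C) (hwK : ∀ i ω, w i ω ∈ K) (v : (E →L[ℝ] ℝ) → E) (hv : Continuous v)
    (hvK : ∀ z, v z ∈ K) (lam : ℝ) (n : ℕ) :
    Integrable (fun ω => ∑ i ∈ Finset.range n,
      δ i ω (v (lam⁻¹ • ∑ j ∈ Finset.range i, δ j ω) - w i ω)) Pr ∧
    ∫ ω, ∑ i ∈ Finset.range n,
      δ i ω (v (lam⁻¹ • ∑ j ∈ Finset.range i, δ j ω) - w i ω) ∂Pr = 0 := by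
  have hmv : ∀ i, StronglyMeasurable[G i]
      (fun ω => v (lam⁻¹ • ∑ j ∈ Finset.range i, δ j ω) - w i ω) := by
    intro i
    refine StronglyMeasurable.sub ?_ (hw i)
    refine hv.comp_stronglyMeasurable (StronglyMeasurable.const_smul' ?_ _)
    refine Finset.stronglyMeasurable_fun_sum _ fun j hj => ?_
    exact (hmeas j).mono (hmono (Finset.mem_range.1 hj))
  have key : ∀ i, _ := fun i => zero_mean (hG i) (hint i) (hz i) (hmv i) (C := C + C)
    (fun ω => (norm_sub_le _ _).trans (add_le_add (hC _ (hvK _)) (hC _ (hwK i ω))))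
  refine ⟨integrable_finsetSum _ fun i _ => (key i).1, ?_⟩
  rw [integral_finsetSum _ fun i _ => (key i).1]
  exact Finset.sum_eq_zero fun i _ => (key i).2

lemma second_moment {m : MeasurableSpace Ω} (hm : m ≤ m0) {φ : Ω → ℝ} {s : ℝ}
    (hv : ∀ᵐ ω ∂Pr, (Pr[φ | m]) ω ≤ s) :
    ∫ ω, φ ω ∂Pr ≤ s := by
  rw [← integral_condExp hm]
  have := integral_mono_ae (μ := Pr) (integrable_condExp (f := φ) (m := m))
    (integrable_const s) hv
  simpa using this

lemma sq_add_bound {a b : Ω → E →L[ℝ] ℝ} (ha : Integrable a Pr) (hb : Integrable b Pr)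
    (ha2 : Integrable (fun ω => ‖a ω‖ ^ 2) Pr) (hb2 : Integrable (fun ω => ‖b ω‖ ^ 2) Pr)
    {s t : ℝ} (hs : ∫ ω, ‖a ω‖ ^ 2 ∂Pr ≤ s) (ht : ∫ ω, ‖b ω‖ ^ 2 ∂Pr ≤ t) :
    (Integrable (fun ω => ‖a ω + b ω‖ ^ 2) Pr ∧ ∫ ω, ‖a ω + b ω‖ ^ 2 ∂Pr ≤ 2 * (s + t)) ∧
    (Integrable (fun ω => ‖a ω - b ω‖ ^ 2) Pr ∧ ∫ ω, ‖a ω - b ω‖ ^ 2 ∂Pr ≤ 2 * (s + t)) := by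
  have hd : Integrable (fun ω => 2 * (‖a ω‖ ^ 2 + ‖b ω‖ ^ 2)) Pr := (ha2.add hb2).const_mul 2
  have hdv : ∫ ω, 2 * (‖a ω‖ ^ 2 + ‖b ω‖ ^ 2) ∂Pr ≤ 2 * (s + t) := by
    rw [integral_const_mul, integral_add ha2 hb2]
    linarith
  have gen : ∀ c : Ω → E →L[ℝ] ℝ, AEStronglyMeasurable c Pr →
      (∀ ω, ‖c ω‖ ≤ ‖a ω‖ + ‖b ω‖) →
      Integrable (fun ω => ‖c ω‖ ^ 2) Pr ∧ ∫ ω, ‖c ω‖ ^ 2 ∂Pr ≤ 2 * (s + t) := by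
    intro c hc hle
    have hp : ∀ ω, ‖c ω‖ ^ 2 ≤ 2 * (‖a ω‖ ^ 2 + ‖b ω‖ ^ 2) := by
      intro ω
      have h1 := pow_le_pow_left₀ (norm_nonneg _) (hle ω) 2
      linarith [sq_nonneg (‖a ω‖ - ‖b ω‖)]
    have hi : Integrable (fun ω => ‖c ω‖ ^ 2) Pr := by
      refine Integrable.mono' hd (hc.norm.pow 2) (Eventually.of_forall fun ω => ?_)
      rw [Real.norm_of_nonneg (by positivity)]
      exact hp ω
    exact ⟨hi, (integral_mono hi hd hp).trans hdv⟩
  exact ⟨gen _ (ha.1.add hb.1) fun ω => norm_add_le _ _,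
    gen _ (ha.1.sub hb.1) fun ω => norm_sub_le _ _⟩

/-- Expectation of a nonnegative combination. -/
lemma sum_moment {φ : ℕ → Ω → ℝ} {c : ℕ → ℝ} {s C : ℝ} (hs : 0 ≤ s)
    (hφ : ∀ i, Integrable (φ i) Pr) (hv : ∀ i, ∫ ω, φ i ω ∂Pr ≤ s) (n : ℕ)
    (hc0 : ∀ i, 0 ≤ c i) (hc : ∀ i < n, c i ≤ C) :
    Integrable (fun ω => ∑ i ∈ Finset.range n, c i * φ i ω) Pr ∧
      ∫ ω, ∑ i ∈ Finset.range n, c i * φ i ω ∂Pr ≤ n * (C * s) := by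
  have hi : ∀ i, Integrable (fun ω => c i * φ i ω) Pr := fun i => (hφ i).const_mul _
  refine ⟨integrable_finsetSum _ fun i _ => hi i, ?_⟩
  rw [integral_finsetSum _ fun i _ => hi i]
  refine (Finset.sum_le_sum (g := fun _ => C * s) fun i hin => ?_).trans (by simp)
  rw [integral_const_mul]
  exact (mul_le_mul_of_nonneg_left (hv i) (hc0 i)).trans
    (mul_le_mul_of_nonneg_right (hc i (Finset.mem_range.1 hin)) hs)

end Prob

section Final

lemma integrable_add_clm {G : Type*} [NormedAddCommGroup G] {Ω : Type*} {m0 : MeasurableSpace Ω}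
    {Pr : Measure Ω} {a b : Ω → G} (ha : Integrable a Pr) (hb : Integrable b Pr) :
    Integrable (a + b) Pr := ha.add hb

lemma final_scalar {L M Λ A B OX OY σ σx ρ ρ' n T : ℝ} (hn : 1 ≤ n) (hT : T = n + 1)
    (hL : 0 ≤ L) (hM : 0 ≤ M) (hΛ : 0 ≤ Λ) (hOX : 0 ≤ OX) (hOY : 0 ≤ OY)
    (hσ : 0 < σ) (hσx : 0 < σx) (hρ : 0 < ρ) (hρ' : 0 < ρ')
    (hA : A = ρ * σ) (hB : B = ρ' * σx) :
    2 / (n * T) * (cXf L M B n * OX + cYf Λ A n * OY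
      + (B * (n * √n)) * OX + (A * (n * √n)) * OY
      + n * (3 * √n / (4 * B) * (2 * σx ^ 2)) + n * (√n / (2 * A) * σ ^ 2)
      + (n + 1) * (√n / (32 * A) * (4 * σ ^ 2)))
    ≤ 16 * L / (T * (T - 1)) * OX + 8 * M / T * OX + 128 * Λ / T * OY
      + 8 * σ / √T * (1 / ρ + 16 * ρ * OY) + 8 * σx / √T * (1 / ρ' + ρ' * OX) := by
  have hn0 : 0 < n := by linarith
  have hT0 : 0 < T := by linarith
  have hsT : 0 < √T := Real.sqrt_pos.2 hT0
  have hr : √n / T ≤ 1 / √T := by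
    rw [div_le_div_iff₀ hT0 hsT, one_mul]
    calc √n * √T ≤ √T * √T := by
          refine mul_le_mul_of_nonneg_right (Real.sqrt_le_sqrt (by linarith)) hsT.le
      _ = T := Real.mul_self_sqrt hT0.le
  have hrn : 0 ≤ √n / T := by positivity
  set r := √n / T with hrdef
  have e1 : 2 / (n * T) * (cXf L M B n * OX + cYf Λ A n * OY
      + (B * (n * √n)) * OX + (A * (n * √n)) * OY
      + n * (3 * √n / (4 * B) * (2 * σx ^ 2)) + n * (√n / (2 * A) * σ ^ 2)
      + (n + 1) * (√n / (32 * A) * (4 * σ ^ 2)))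
      = 8 * L / (T * n) * OX + 4 * M / T * OX + 32 * Λ / T * OY
        + r * (6 * ρ' * σx * OX) + r * (34 * ρ * σ * OY) + r * (3 * σx / ρ')
        + r * (σ / ρ) + r * ((n + 1) / n * (σ / (4 * ρ))) := by
    rw [hrdef, hA, hB]
    unfold cXf cYf
    field_simp
    ring
  rw [e1]
  have hTn : T - 1 = n := by rw [hT]; ring
  rw [hTn]
  have q : (n + 1) / n ≤ 2 := by rw [div_le_iff₀ hn0]; linarith
  have b1 : 8 * L / (T * n) * OX ≤ 16 * L / (T * n) * OX := by
    gcongr; norm_num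
  have b2 : 4 * M / T * OX ≤ 8 * M / T * OX := by
    gcongr; norm_num
  have b3 : 32 * Λ / T * OY ≤ 128 * Λ / T * OY := by
    gcongr; norm_num
  have b4 : r * (6 * ρ' * σx * OX) ≤ 1 / √T * (8 * ρ' * σx * OX) := by
    gcongr; norm_num
  have b5 : r * (34 * ρ * σ * OY) ≤ 1 / √T * (128 * ρ * σ * OY) := by
    gcongr; norm_num
  have b6 : r * (3 * σx / ρ') ≤ 1 / √T * (8 * σx / ρ') := by
    gcongr; norm_num
  have b7 : r * (σ / ρ) ≤ 1 / √T * (σ / ρ) := by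
    gcongr
  have b8 : r * ((n + 1) / n * (σ / (4 * ρ))) ≤ 1 / √T * (2 * (σ / (4 * ρ))) := by
    gcongr
  have b9 : 0 ≤ 1 / √T * (σ / ρ) := by positivity
  have e2 : 8 * σ / √T * (1 / ρ + 16 * ρ * OY) =
      8 * (1 / √T * (σ / ρ)) + 1 / √T * (128 * ρ * σ * OY) := by
    field_simp
    ring
  have e3 : 8 * σx / √T * (1 / ρ' + ρ' * OX) =
      1 / √T * (8 * σx / ρ') + 1 / √T * (8 * ρ' * σx * OX) := by
    field_simp
  have e4 : 1 / √T * (2 * (σ / (4 * ρ))) = 1 / 2 * (1 / √T * (σ / ρ)) := by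
    field_simp
    norm_num
  rw [e2, e3]
  rw [e4] at b8
  linarith

lemma alpha_step {Λ A t a : ℝ} (ht : 1 ≤ t) (hΛ : 0 ≤ Λ) (hA : 0 < A)
    (ha : a = 1 / (16 * (Λ + A * √t))) : t * a⁻¹ = cYf Λ A t ∧ 0 < a⁻¹ := by
  have : 0 < √t := Real.sqrt_pos.2 (by linarith)
  have h : 0 < 16 * (Λ + A * √t) := by positivity
  rw [ha, one_div, inv_inv]
  refine ⟨?_, h⟩
  unfold cYf
  ring

lemma tau_step {L M B t a : ℝ} (ht : 1 ≤ t) (hL : 0 ≤ L) (hM : 0 ≤ M) (hB : 0 < B)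
    (ha : a = t / (2 * (2 * L + M * t + B * t ^ ((3 : ℝ) / 2)))) :
    t * a⁻¹ = cXf L M B t ∧ 0 < a⁻¹ := by
  have ht0 : 0 < t := by linarith
  have h32 : t ^ ((3 : ℝ) / 2) = t * √t := by
    rw [Real.sqrt_eq_rpow, show (3 : ℝ) / 2 = 1 + 1 / 2 by norm_num, Real.rpow_add ht0,
      Real.rpow_one]
  have hs : 0 < √t := Real.sqrt_pos.2 ht0
  rw [h32] at ha
  have h : 0 < 2 * (2 * L + M * t + B * (t * √t)) := by positivity
  rw [ha, inv_div]
  refine ⟨?_, by positivity⟩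
  unfold cXf
  field_simp
  ring

lemma coef_bounds {k n A : ℝ} (hk : 0 ≤ k) (hkn : k + 1 ≤ n) (hA : 0 < A) :
    1 / (2 * (A * (n * √n))) * (k + 1) ^ 2 ≤ √n / (2 * A) ∧
    √(k + 1) ≤ √n := by
  have hn : 0 < n := by linarith
  have hs : 0 < √n := Real.sqrt_pos.2 hn
  refine ⟨?_, Real.sqrt_le_sqrt hkn⟩
  have h1 : (k + 1) ^ 2 ≤ n ^ 2 := pow_le_pow_left₀ (by linarith) hkn 2
  have e : √n / (2 * A) = 1 / (2 * (A * (n * √n))) * n ^ 2 := by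
    have h2 : √n * √n = n := Real.mul_self_sqrt hn.le
    field_simp
    rw [pow_two, h2]
  rw [e]
  exact mul_le_mul_of_nonneg_left h1 (by positivity)

end Final

set_option maxHeartbeats 4000000

/-- Theorem 3.1(A): with the stepsize choices
`θ_t = (t-1)/t`, `β_t = 2/(t+1)`, `α_t = 1/(16(L_yx+L_yy+ρσ_{y,Φ}√t))`,
`τ_t = t/(2(2L+(L_xx+L_yx)t+ρ'(σ_{x,Φ}+σ_{x,f})t^{3/2}))`, and unbiased noises with
conditionally bounded second moments, for every `T ≥ 3`, `E[G(x̄ᵀ,ȳᵀ)] ≤ B_E(T)`. -/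
theorem algorithm1_theorem_expected_gap_bound
    {𝕏 𝕐 : Type*} [NormedAddCommGroup 𝕏] [NormedSpace ℝ 𝕏] [FiniteDimensional ℝ 𝕏]
    [NormedAddCommGroup 𝕐] [NormedSpace ℝ 𝕐] [FiniteDimensional ℝ 𝕐]
    {Ω : Type*} {mΩ : MeasurableSpace Ω} (Pr : MeasureTheory.Measure Ω)
    [MeasureTheory.IsProbabilityMeasure Pr] (F : MeasureTheory.Filtration ℕ mΩ)
    (X : Set 𝕏) (Y : Set 𝕐)
    (hXne : X.Nonempty) (hXcl : IsClosed X) (hXconv : Convex ℝ X)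
    (hYne : Y.Nonempty) (hYcl : IsClosed Y) (hYconv : Convex ℝ Y)
    (L Lxx Lyx Lyy : ℝ) (hL : 0 ≤ L) (hLxx : 0 ≤ Lxx) (hLyx : 0 ≤ Lyx) (hLyy : 0 ≤ Lyy)
    -- f : L-smooth and convex on X, with gradient field Df
    (f : 𝕏 → ℝ) (Df : 𝕏 → 𝕏 →L[ℝ] ℝ)
    (hf_cvx : ConvexOn ℝ X f)
    (hf_deriv : ∀ x ∈ X, HasFDerivAt f (Df x) x)
    (hf_smooth : ∀ x ∈ X, ∀ x' ∈ X, ‖Df x - Df x'‖ ≤ L * ‖x - x'‖)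
    -- g, J : CCP nonsmooth terms
    (g : 𝕏 → EReal) (hg : IsCCP g) (hgX : (edom g ∩ X).Nonempty)
    (J : 𝕐 → EReal) (hJ : IsCCP J) (hJY : (edom J ∩ Y).Nonempty)
    -- Φ : convex-concave coupling with Lipschitz partial gradients
    (Φ : 𝕏 → 𝕐 → ℝ)
    (DxΦ : 𝕏 → 𝕐 → 𝕏 →L[ℝ] ℝ) (DyΦ : 𝕏 → 𝕐 → 𝕐 →L[ℝ] ℝ)
    (hΦcvx : ∀ y ∈ Y, ConvexOn ℝ X (fun x => Φ x y))
    (hΦccv : ∀ x ∈ X, ConcaveOn ℝ Y (Φ x))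
    (hΦdx : ∀ x ∈ X, ∀ y ∈ Y, HasFDerivAt (fun x' => Φ x' y) (DxΦ x y) x)
    (hΦdy : ∀ x ∈ X, ∀ y ∈ Y, HasFDerivAt (fun y' => Φ x y') (DyΦ x y) y)
    (hΦxx : ∀ x ∈ X, ∀ x' ∈ X, ∀ y ∈ Y, ‖DxΦ x y - DxΦ x' y‖ ≤ Lxx * ‖x - x'‖)
    (hΦyx1 : ∀ x ∈ X, ∀ y ∈ Y, ∀ y' ∈ Y, ‖DxΦ x y - DxΦ x y'‖ ≤ Lyx * ‖y - y'‖)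
    (hΦyx2 : ∀ x ∈ X, ∀ x' ∈ X, ∀ y ∈ Y, ‖DyΦ x y - DyΦ x' y‖ ≤ Lyx * ‖x - x'‖)
    (hΦyy : ∀ x ∈ X, ∀ y ∈ Y, ∀ y' ∈ Y, ‖DyΦ x y - DyΦ x y'‖ ≤ Lyy * ‖y - y'‖)
    -- DGFs on X and Y with finite Bregman diameters ΩX, ΩY
    (dgfX : 𝕏 → EReal) (DdgfX : 𝕏 → 𝕏 →L[ℝ] ℝ) (hdgfX : IsDGF dgfX DdgfX X)
    (dgfY : 𝕐 → EReal) (DdgfY : 𝕐 → 𝕐 →L[ℝ] ℝ) (hdgfY : IsDGF dgfY DdgfY Y)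
    (ΩX ΩY : ℝ)
    (hΩX : (⨆ x ∈ X, ⨆ x' ∈ X ∩ interior (edom dgfX), Dbreg dgfX DdgfX x x')
      = (ΩX : EReal))
    (hΩY : (⨆ y ∈ Y, ⨆ y' ∈ Y ∩ interior (edom dgfY), Dbreg dgfY DdgfY y y')
      = (ΩY : EReal))

    -- Algorithm 1: stepsize sequences and iterates
    (θ β α τ : ℕ → ℝ)
    (xs xb xt : ℕ → Ω → 𝕏) (ys yb : ℕ → Ω → 𝕐)
    (s : ℕ → Ω → 𝕐 →L[ℝ] ℝ)
    -- stochastic gradient oracle outputs at step t: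
    -- Gf t = ∇̂f(x̃^{t+1}), GxΦ t = ∇̂ₓΦ(xᵗ,y^{t+1}), GyΦ t = ∇̂_yΦ(xᵗ,yᵗ)
    (Gf GxΦ : ℕ → Ω → 𝕏 →L[ℝ] ℝ) (GyΦ : ℕ → Ω → 𝕐 →L[ℝ] ℝ)
    (hinit_x : ∀ ω, xs 1 ω ∈ X ∩ interior (edom dgfX))
    (hinit_y : ∀ ω, ys 1 ω ∈ Y ∩ interior (edom dgfY))
    (hinit_xb : xb 1 = xs 1) (hinit_yb : yb 1 = ys 1) (hinit_s : s 1 = GyΦ 1)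
    (hstep_y : ∀ t, 1 ≤ t → ∀ ω, ys (t+1) ω ∈ Y ∩ interior (edom dgfY) ∧
      ∀ y ∈ Y,
        J (ys (t+1) ω) + ((-((s t ω) (ys (t+1) ω - ys t ω)) : ℝ) : EReal)
            + (((α t)⁻¹ : ℝ) : EReal) * Dbreg dgfY DdgfY (ys (t+1) ω) (ys t ω)
          ≤ J y + ((-((s t ω) (y - ys t ω)) : ℝ) : EReal)
            + (((α t)⁻¹ : ℝ) : EReal) * Dbreg dgfY DdgfY y (ys t ω))
    (hstep_xt : ∀ t, 1 ≤ t → ∀ ω, xt (t+1) ω = (1 - β t) • xb t ω + β t • xs t ω)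
    (hstep_x : ∀ t, 1 ≤ t → ∀ ω, xs (t+1) ω ∈ X ∩ interior (edom dgfX) ∧
      ∀ x ∈ X,
        g (xs (t+1) ω) + (((GxΦ t ω + Gf t ω) (xs (t+1) ω - xs t ω) : ℝ) : EReal)
            + (((τ t)⁻¹ : ℝ) : EReal) * Dbreg dgfX DdgfX (xs (t+1) ω) (xs t ω)
          ≤ g x + (((GxΦ t ω + Gf t ω) (x - xs t ω) : ℝ) : EReal)
            + (((τ t)⁻¹ : ℝ) : EReal) * Dbreg dgfX DdgfX x (xs t ω))
    (hstep_s : ∀ t, 1 ≤ t → ∀ ω,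
      s (t+1) ω = (1 + θ (t+1)) • GyΦ (t+1) ω - θ (t+1) • GyΦ t ω)
    (hstep_xb : ∀ t, 1 ≤ t → ∀ ω, xb (t+1) ω = (1 - β t) • xb t ω + β t • xs (t+1) ω)
    (hstep_yb : ∀ t, 1 ≤ t → ∀ ω, yb (t+1) ω = (1 - β t) • yb t ω + β t • ys (t+1) ω)

    -- gradient noises, adaptedness and unbiasedness
    (δyΦ : ℕ → Ω → 𝕐 →L[ℝ] ℝ) (δxΦ δxf : ℕ → Ω → 𝕏 →L[ℝ] ℝ)
    (hδyΦ : ∀ t ω, δyΦ t ω = GyΦ t ω - DyΦ (xs t ω) (ys t ω))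
    (hδxΦ : ∀ t ω, δxΦ t ω = GxΦ t ω - DxΦ (xs t ω) (ys (t+1) ω))
    (hδxf : ∀ t ω, δxf t ω = Gf t ω - Df (xt (t+1) ω))
    (hadapt_x : ∀ t, 1 ≤ t → StronglyMeasurable[F (t-1)] (xs t))
    (hadapt_y : ∀ t, 1 ≤ t → StronglyMeasurable[F (t-1)] (ys t))
    (hmeas : ∀ t, 1 ≤ t → StronglyMeasurable[F t] (δyΦ t) ∧
      StronglyMeasurable[F t] (δxΦ t) ∧ StronglyMeasurable[F t] (δxf t))
    (hint : ∀ t, 1 ≤ t → MeasureTheory.Integrable (δyΦ t) Pr ∧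
      MeasureTheory.Integrable (δxΦ t) Pr ∧ MeasureTheory.Integrable (δxf t) Pr)
    (hunbiased : ∀ t, 1 ≤ t → (Pr[δyΦ t | F (t-1)] =ᵐ[Pr] 0) ∧
      (Pr[δxΦ t | F (t-1)] =ᵐ[Pr] 0) ∧ (Pr[δxf t | F (t-1)] =ᵐ[Pr] 0))
    (σyΦ σxΦ σxf : ℝ) (hσy : 0 < σyΦ) (hσxΦ : 0 < σxΦ) (hσxf : 0 < σxf)

    -- conditionally bounded second moments
    (hvar_int : ∀ t, 1 ≤ t → MeasureTheory.Integrable (fun ω => ‖δyΦ t ω‖ ^ 2) Pr ∧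
      MeasureTheory.Integrable (fun ω => ‖δxΦ t ω‖ ^ 2) Pr ∧
      MeasureTheory.Integrable (fun ω => ‖δxf t ω‖ ^ 2) Pr)
    (hvar : ∀ t, 1 ≤ t →
      (∀ᵐ ω ∂Pr, (Pr[fun ω' => ‖δyΦ t ω'‖ ^ 2 | F (t-1)]) ω ≤ σyΦ ^ 2) ∧
      (∀ᵐ ω ∂Pr, (Pr[fun ω' => ‖δxΦ t ω'‖ ^ 2 | F (t-1)]) ω ≤ σxΦ ^ 2) ∧
      (∀ᵐ ω ∂Pr, (Pr[fun ω' => ‖δxf t ω'‖ ^ 2 | F (t-1)]) ω ≤ σxf ^ 2))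

    -- parameter choices of Theorem 3.1
    (ρ ρ' : ℝ) (hρ : 0 < ρ) (hρ' : 0 < ρ')
    (hθ : ∀ t : ℕ, 1 ≤ t → θ t = ((t : ℝ) - 1) / t)
    (hβ : ∀ t : ℕ, 1 ≤ t → β t = 2 / ((t : ℝ) + 1))
    (hα : ∀ t : ℕ, 1 ≤ t →
      α t = 1 / (16 * (Lyx + Lyy + ρ * σyΦ * Real.sqrt t)))
    (hτ : ∀ t : ℕ, 1 ≤ t →
      τ t = (t : ℝ) / (2 * (2 * L + (Lxx + Lyx) * t
        + ρ' * (σxΦ + σxf) * (t : ℝ) ^ ((3 : ℝ) / 2))))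
 :
    ∀ T : ℕ, 3 ≤ T →
      ∫⁻ ω, toENN (spGap X Y f g Φ J (xb T ω) (yb T ω)) ∂Pr
        ≤ ENNReal.ofReal (16 * L / (T * ((T:ℝ) - 1)) * ΩX + 8 * (Lxx + Lyx) / T * ΩX
            + 128 * (Lyx + Lyy) / T * ΩY
            + 8 * σyΦ / Real.sqrt T * (1 / ρ + 16 * ρ * ΩY)
            + 8 * (σxf + σxΦ) / Real.sqrt T * (1 / ρ' + ρ' * ΩX)) := by
  intro T hT
  obtain ⟨n, rfl⟩ : ∃ n, T = n + 1 := ⟨T - 1, by omega⟩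
  have hn1 : 1 ≤ n := by omega
  have hn1r : (1:ℝ) ≤ (n:ℝ) := by exact_mod_cast hn1
  have hn0r : (0:ℝ) < (n:ℝ) := by linarith
  obtain ⟨ω0⟩ : Nonempty Ω := nonempty_of_isProbabilityMeasure Pr
  set σx : ℝ := σxΦ + σxf with hσxdef
  have hσx : 0 < σx := by positivity
  obtain ⟨A, hA⟩ : ∃ A, A = ρ * σyΦ := ⟨_, rfl⟩
  obtain ⟨B, hB⟩ : ∃ B, B = ρ' * σx := ⟨_, rfl⟩
  have hA0 : 0 < A := by rw [hA]; positivity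
  have hB0 : 0 < B := by rw [hB]; positivity
  have hα' : ∀ t : ℕ, 1 ≤ t → t * (α t)⁻¹ = cYf (Lyx + Lyy) A t ∧ 0 < (α t)⁻¹ := by
    intro t ht
    refine alpha_step (by exact_mod_cast ht) (by positivity) hA0 ?_
    rw [hα t ht, hA]
  have hτ' : ∀ t : ℕ, 1 ≤ t → t * (τ t)⁻¹ = cXf L (Lxx + Lyx) B t ∧ 0 < (τ t)⁻¹ := by
    intro t ht
    refine tau_step (by exact_mod_cast ht) hL (by positivity) hB0 ?_
    rw [hτ t ht, hB]
  -- total noise in `x`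
  obtain ⟨δx, hδx⟩ : ∃ δx : ℕ → Ω → 𝕏 →L[ℝ] ℝ, ∀ t ω, δx t ω = δxΦ t ω + δxf t ω :=
    ⟨fun t ω => δxΦ t ω + δxf t ω, fun _ _ => rfl⟩
  have hδxf' : ∀ t, δx t = δxΦ t + δxf t := fun t => funext fun ω => hδx t ω
  have path : ∀ ω, _ := fun ω => path_bound X Y hXconv hYconv L Lxx Lyx Lyy hL hLxx hLyx hLyy
    f Df hf_cvx hf_deriv hf_smooth g hg hgX J hJ hJY Φ DxΦ DyΦ hΦcvx hΦccv hΦdx hΦdy hΦxx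
    hΦyx2 hΦyy dgfX DdgfX hdgfX dgfY DdgfY hdgfY ΩX ΩY hΩX hΩY θ β α τ
    (fun t => xs t ω) (fun t => xb t ω) (fun t => xt t ω) (fun t => ys t ω) (fun t => yb t ω)
    (fun t => s t ω) (fun t => Gf t ω) (fun t => GxΦ t ω) (fun t => GyΦ t ω)
    (hinit_x ω) (hinit_y ω) (by simp [hinit_xb]) (by simp [hinit_yb]) (by simp [hinit_s])
    (fun t ht => hstep_y t ht ω) (fun t ht => hstep_xt t ht ω) (fun t ht => hstep_x t ht ω)
    (fun t ht => hstep_s t ht ω) (fun t ht => hstep_xb t ht ω) (fun t ht => hstep_yb t ht ω)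
    (fun t => δyΦ t ω) (fun t => δx t ω) (fun t => hδyΦ t ω)
    (fun t => by rw [hδx, hδxΦ, hδxf]) A B hA0 hB0 hθ hβ hα' hτ'
  have hcX := dgf_coe hdgfX _ (hinit_x ω0) hΩX
  have hcY := dgf_coe hdgfY _ (hinit_y ω0) hΩY
  have hOX : 0 ≤ ΩX := by
    have := dgf_bounds hdgfX hΩX hcX (hinit_x ω0).1 (hinit_x ω0)
    exact le_trans (by positivity) (this.1.trans this.2)
  have hOY : 0 ≤ ΩY := by
    have := dgf_bounds hdgfY hΩY hcY (hinit_y ω0).1 (hinit_y ω0)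
    exact le_trans (by positivity) (this.1.trans this.2)
  obtain ⟨CX, hCX⟩ := (dgf_compact hXcl hdgfX _ (hinit_x ω0) hΩX).isBounded.exists_norm_le
  obtain ⟨CY, hCY⟩ := (dgf_compact hYcl hdgfY _ (hinit_y ω0) hΩY).isBounded.exists_norm_le
  obtain ⟨vx, hvxc, hvxK, hvx⟩ := dgf_regret hXcl hXconv hdgfX _ (hinit_x ω0) hΩX
  obtain ⟨vy, hvyc, hvyK, hvy⟩ := dgf_regret hYcl hYconv hdgfY _ (hinit_y ω0) hΩY
  have hxsX : ∀ k ω, xs (k + 1) ω ∈ X := by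
    intro k ω
    rcases k with _ | k
    · exact (hinit_x ω).1
    · exact (hstep_x (k + 1) (by omega) ω).1.1
  have hysY : ∀ k ω, ys (k + 1) ω ∈ Y := by
    intro k ω
    rcases k with _ | k
    · exact (hinit_y ω).1
    · exact (hstep_y (k + 1) (by omega) ω).1.1
  -- scaled noises
  obtain ⟨dx, hdx⟩ : ∃ dx : ℕ → Ω → 𝕏 →L[ℝ] ℝ, ∀ i, dx i = ((i:ℝ) + 1) • δx (i + 1) :=
    ⟨_, fun _ => rfl⟩
  obtain ⟨dy, hdy⟩ : ∃ dy : ℕ → Ω → 𝕐 →L[ℝ] ℝ, ∀ i, dy i = (-((i:ℝ) + 1)) • δyΦ (i + 2) :=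
    ⟨_, fun _ => rfl⟩
  obtain ⟨lx, hlx⟩ : ∃ lx : ℝ, lx = B * (n * √(n:ℝ)) := ⟨_, rfl⟩
  obtain ⟨ly, hly⟩ : ∃ ly : ℝ, ly = A * (n * √(n:ℝ)) := ⟨_, rfl⟩
  have hsn : 0 < √(n:ℝ) := Real.sqrt_pos.2 hn0r
  have hlx0 : 0 < lx := by rw [hlx]; positivity
  have hly0 : 0 < ly := by rw [hly]; positivity
  have hδxint : ∀ i : ℕ, Integrable (δx (i + 1)) Pr := by
    intro i
    rw [hδxf']
    obtain ⟨-, h1, h2⟩ := hint (i + 1) (by omega)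
    exact integrable_add_clm h1 h2
  have Zx := zero_mean_sum (Pr := Pr) (fun i => F i) (fun i => F.le i) (fun a b hab => F.mono hab) dx
    (fun i => xs (i + 1))
    (fun i => by
      rw [hdx, hδxf']
      exact ((hmeas (i + 1) (by omega)).2.1.add (hmeas (i + 1) (by omega)).2.2).const_smul _)
    (fun i => by rw [hdx]; exact (hδxint i).smul _)
    (fun i => by
      rw [hdx, hδxf']
      have h1 := hunbiased (i + 1) (by omega)
      refine (condExp_smul _ _ _).trans ?_
      have h2 := condExp_add (hint (i + 1) (by omega)).2.1 (hint (i + 1) (by omega)).2.2 (F i)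
      filter_upwards [h1.2.1, h1.2.2, h2] with ω a1 a2 a3
      simp only [Nat.add_sub_cancel] at a1 a2
      simp [a1, a2, a3])
    (fun i => hadapt_x (i + 1) (by omega)) hCX (fun i ω => hxsX i ω) vx hvxc hvxK lx n
  have Zy := zero_mean_sum (Pr := Pr) (fun i => F (i + 1)) (fun i => F.le _)
    (fun a b hab => F.mono (by omega)) dy (fun i => ys (i + 2))
    (fun i => by
      rw [hdy]
      exact ((hmeas (i + 2) (by omega)).1).const_smul _)
    (fun i => by rw [hdy]; exact (hint (i + 2) (by omega)).1.smul _)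
    (fun i => by
      rw [hdy]
      have h1 := hunbiased (i + 2) (by omega)
      refine (condExp_smul _ _ _).trans ?_
      filter_upwards [h1.1] with ω a1
      have a1' : (Pr[δyΦ (i + 2) | F (i + 1)]) ω = 0 := a1
      simp [a1'])
    (fun i => hadapt_y (i + 2) (by omega)) hCY (fun i ω => hysY (i + 1) ω) vy hvyc hvyK ly n
  -- second moments
  have hmy : ∀ t, 1 ≤ t → ∫ ω, ‖δyΦ t ω‖ ^ 2 ∂Pr ≤ σyΦ ^ 2 :=
    fun t ht => second_moment (F.le _) (hvar t ht).1
  have hmx : ∀ i : ℕ, Integrable (fun ω => ‖δx (i + 1) ω‖ ^ 2) Pr ∧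
      ∫ ω, ‖δx (i + 1) ω‖ ^ 2 ∂Pr ≤ 2 * σx ^ 2 := by
    intro i
    have h := (sq_add_bound (hint (i + 1) (by omega)).2.1 (hint (i + 1) (by omega)).2.2
      (hvar_int (i + 1) (by omega)).2.1 (hvar_int (i + 1) (by omega)).2.2
      (second_moment (F.le _) (hvar (i + 1) (by omega)).2.1)
      (second_moment (F.le _) (hvar (i + 1) (by omega)).2.2)).1
    simp only [hδx]
    refine ⟨h.1, h.2.trans ?_⟩
    rw [hσxdef]
    nlinarith [mul_pos hσxΦ hσxf]
  obtain ⟨ψ, hψ⟩ : ∃ ψ : ℕ → Ω → ℝ, ∀ k, ψ k = fun ω =>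
    if k = 0 then 0 else ‖δyΦ (k + 1) ω - δyΦ k ω‖ ^ 2 := ⟨_, fun _ => rfl⟩
  have hψm : ∀ k, Integrable (ψ k) Pr ∧ ∫ ω, ψ k ω ∂Pr ≤ 4 * σyΦ ^ 2 := by
    intro k
    rw [hψ]
    rcases k with _ | k
    · simp only [if_true, integral_zero]
      exact ⟨integrable_zero _ _ _, by positivity⟩
    · simp only [Nat.succ_ne_zero, if_false]
      have h := (sq_add_bound (hint (k + 1 + 1) (by omega)).1 (hint (k + 1) (by omega)).1
        (hvar_int (k + 1 + 1) (by omega)).1 (hvar_int (k + 1) (by omega)).1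
        (hmy (k + 1 + 1) (by omega)) (hmy (k + 1) (by omega))).2
      exact ⟨h.1, h.2.trans (by linarith)⟩
  have hcoefB : ∀ i < n, 1 / (2 * lx) * ((i:ℝ) + 1) ^ 2 ≤ √(n:ℝ) / (2 * B) ∧
      √((i:ℝ) + 1) ≤ √(n:ℝ) := by
    intro i hi
    rw [hlx]
    exact coef_bounds (by positivity) (by exact_mod_cast hi) hB0
  have hcoefA : ∀ i < n, 1 / (2 * ly) * ((i:ℝ) + 1) ^ 2 ≤ √(n:ℝ) / (2 * A) := by
    intro i hi
    rw [hly]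
    exact (coef_bounds (by positivity) (by exact_mod_cast hi) hA0).1
  have V1 := sum_moment (Pr := Pr) (φ := fun i ω => ‖δx (i + 1) ω‖ ^ 2)
    (c := fun i => 1 / (2 * lx) * ((i:ℝ) + 1) ^ 2 + √((i:ℝ) + 1) / (4 * B))
    (C := 3 * √(n:ℝ) / (4 * B)) (s := 2 * σx ^ 2) (by positivity)
    (fun i => (hmx i).1) (fun i => (hmx i).2) n (fun i => by positivity)
    (fun i hi => by
      have h1 := (hcoefB i hi).1
      have h2 : √((i:ℝ) + 1) / (4 * B) ≤ √(n:ℝ) / (4 * B) :=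
        div_le_div_of_nonneg_right (hcoefB i hi).2 (by positivity)
      have h3 : 3 * √(n:ℝ) / (4 * B) = √(n:ℝ) / (2 * B) + √(n:ℝ) / (4 * B) := by
        field_simp; norm_num
      beta_reduce
      rw [h3]
      exact add_le_add h1 h2)
  have V2 := sum_moment (Pr := Pr) (φ := fun i ω => ‖δyΦ (i + 2) ω‖ ^ 2)
    (c := fun i => 1 / (2 * ly) * ((i:ℝ) + 1) ^ 2)
    (C := √(n:ℝ) / (2 * A)) (s := σyΦ ^ 2) (by positivity)
    (fun i => (hvar_int (i + 2) (by omega)).1) (fun i => hmy (i + 2) (by omega)) n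
    (fun i => by positivity) (fun i hi => hcoefA i hi)
  have V3 := sum_moment (Pr := Pr) (φ := ψ)
    (c := fun i => √(i:ℝ) / (32 * A))
    (C := √(n:ℝ) / (32 * A)) (s := 4 * σyΦ ^ 2) (by positivity)
    (fun i => (hψm i).1) (fun i => (hψm i).2) (n + 1)
    (fun i => by positivity) (fun i hi => by
      have : (i:ℝ) ≤ n := by exact_mod_cast Nat.lt_succ_iff.1 hi
      exact div_le_div_of_nonneg_right (Real.sqrt_le_sqrt this) (by positivity))
  obtain ⟨zx, hzx⟩ : ∃ zx : Ω → ℝ, zx = fun ω => ∑ i ∈ Finset.range n,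
      dx i ω (vx (lx⁻¹ • ∑ j ∈ Finset.range i, dx j ω) - xs (i + 1) ω) := ⟨_, rfl⟩
  obtain ⟨zy, hzy⟩ : ∃ zy : Ω → ℝ, zy = fun ω => ∑ i ∈ Finset.range n,
      dy i ω (vy (ly⁻¹ • ∑ j ∈ Finset.range i, dy j ω) - ys (i + 2) ω) := ⟨_, rfl⟩
  obtain ⟨v1, hv1⟩ : ∃ v1 : Ω → ℝ, v1 = fun ω => ∑ i ∈ Finset.range n,
      (1 / (2 * lx) * ((i:ℝ) + 1) ^ 2 + √((i:ℝ) + 1) / (4 * B)) * ‖δx (i + 1) ω‖ ^ 2 := ⟨_, rfl⟩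
  obtain ⟨v2, hv2⟩ : ∃ v2 : Ω → ℝ, v2 = fun ω => ∑ i ∈ Finset.range n,
      (1 / (2 * ly) * ((i:ℝ) + 1) ^ 2) * ‖δyΦ (i + 2) ω‖ ^ 2 := ⟨_, rfl⟩
  obtain ⟨v3, hv3⟩ : ∃ v3 : Ω → ℝ, v3 = fun ω => ∑ i ∈ Finset.range (n + 1),
      √(i:ℝ) / (32 * A) * ψ i ω := ⟨_, rfl⟩
  rw [← hzx] at Zx
  rw [← hzy] at Zy
  rw [← hv1] at V1
  rw [← hv2] at V2
  rw [← hv3] at V3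
  have IZx : ∫ ω, zx ω ∂Pr = 0 := by exact Zx.2
  have IZy : ∫ ω, zy ω ∂Pr = 0 := by exact Zy.2
  have I1 : ∫ ω, v1 ω ∂Pr ≤ n * (3 * √(n:ℝ) / (4 * B) * (2 * σx ^ 2)) := by
    exact V1.2
  have I2 : ∫ ω, v2 ω ∂Pr ≤ n * (√(n:ℝ) / (2 * A) * σyΦ ^ 2) := by
    exact V2.2
  have I3 : ∫ ω, v3 ω ∂Pr ≤ ((n:ℝ) + 1) * (√(n:ℝ) / (32 * A) * (4 * σyΦ ^ 2)) := by
    have := V3.2; push_cast at this; exact this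
  -- pathwise bound
  obtain ⟨C0, hC0⟩ : ∃ C0 : ℝ, C0 = cXf L (Lxx + Lyx) B n * ΩX + cYf (Lyx + Lyy) A n * ΩY
    + lx * ΩX + ly * ΩY := ⟨_, rfl⟩
  have hpath : ∀ ω, ∀ x ∈ X, x ∈ edom g → ∀ y ∈ Y, y ∈ edom J →
      (n : ℝ) * (n + 1) / 2 * rQ f g Φ J (xb (n + 1) ω) (yb (n + 1) ω) x y ≤
        C0 + zx ω + zy ω + v1 ω + v2 ω + v3 ω := by
    intro ω x hx hxg y hy hyJ
    have h := (path ω).2 n x hx hxg y hy hyJ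
    have hx1 := hvx lx hlx0 (fun i => dx i ω) n x hx
    have hy1 := hvy ly hly0 (fun i => dy i ω) n y hy
    have ex : ∀ i, dx i ω = ((i:ℝ) + 1) • δx (i + 1) ω := fun i => by rw [hdx]; rfl
    have ey : ∀ i, dy i ω = (-((i:ℝ) + 1)) • δyΦ (i + 2) ω := fun i => by rw [hdy]; rfl
    have sx : ∑ k ∈ Finset.range n, ((k : ℝ) + 1) * δx (k + 1) ω (x - xs (k + 1) ω)
        = ∑ i ∈ Finset.range n, dx i ω x - ∑ i ∈ Finset.range n, dx i ω (xs (i + 1) ω) := by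
      rw [← Finset.sum_sub_distrib]
      refine Finset.sum_congr rfl fun i _ => ?_
      rw [ex, map_sub, smul_apply, smul_apply, smul_eq_mul, smul_eq_mul]; ring
    have sy : ∑ k ∈ Finset.range n, ((k : ℝ) + 1) * δyΦ (k + 2) ω (y - ys (k + 2) ω)
        = - (∑ i ∈ Finset.range n, dy i ω y - ∑ i ∈ Finset.range n, dy i ω (ys (i + 2) ω)) := by
      rw [← Finset.sum_sub_distrib, ← Finset.sum_neg_distrib]
      refine Finset.sum_congr rfl fun i _ => ?_
      rw [ey, map_sub, smul_apply, smul_apply, smul_eq_mul, smul_eq_mul]; ring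
    have ezx : zx ω = ∑ i ∈ Finset.range n, dx i ω (vx (lx⁻¹ • ∑ j ∈ Finset.range i, dx j ω))
        - ∑ i ∈ Finset.range n, dx i ω (xs (i + 1) ω) := by
      rw [hzx, ← Finset.sum_sub_distrib]
      refine Finset.sum_congr rfl fun i _ => ?_
      rw [map_sub]
    have ezy : zy ω = ∑ i ∈ Finset.range n, dy i ω (vy (ly⁻¹ • ∑ j ∈ Finset.range i, dy j ω))
        - ∑ i ∈ Finset.range n, dy i ω (ys (i + 2) ω) := by
      rw [hzy, ← Finset.sum_sub_distrib]
      refine Finset.sum_congr rfl fun i _ => ?_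
      rw [map_sub]
    have ev1 : v1 ω = 1 / (2 * lx) * ∑ i ∈ Finset.range n, ‖dx i ω‖ ^ 2
        + ∑ i ∈ Finset.range n, √((i:ℝ) + 1) / (4 * B) * ‖δx (i + 1) ω‖ ^ 2 := by
      rw [hv1, Finset.mul_sum, ← Finset.sum_add_distrib]
      refine Finset.sum_congr rfl fun i _ => ?_
      rw [ex, norm_smul, mul_pow, Real.norm_eq_abs, sq_abs]; ring
    have ev2 : v2 ω = 1 / (2 * ly) * ∑ i ∈ Finset.range n, ‖dy i ω‖ ^ 2 := by
      rw [hv2, Finset.mul_sum]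
      refine Finset.sum_congr rfl fun i _ => ?_
      rw [ey, norm_smul, mul_pow, Real.norm_eq_abs, sq_abs]; ring
    have er : ∀ k : ℕ, √(k:ℝ) / (32 * A) * ‖δyΦ (k + 1) ω - δyΦ k ω‖ ^ 2
        = √(k:ℝ) / (32 * A) * ψ k ω := by
      intro k
      rw [hψ]
      rcases k with _ | k
      · simp
      · simp
    have ev3 : v3 ω = ∑ i ∈ Finset.range n,
          √(i:ℝ) / (32 * A) * ‖δyΦ (i + 1) ω - δyΦ i ω‖ ^ 2
        + √(n:ℝ) / (32 * A) * ‖δyΦ (n + 1) ω - δyΦ n ω‖ ^ 2 := by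
      rw [hv3]
      beta_reduce
      rw [Finset.sum_range_succ, er n]
      congr 1
      exact Finset.sum_congr rfl fun i _ => (er i).symm
    rw [Finset.sum_add_distrib, Finset.sum_sub_distrib, Finset.sum_add_distrib] at h
    rw [sx, sy] at h
    rw [hC0, ezx, ezy, ev1, ev2, ev3]
    linarith
  obtain ⟨Bf, hBf⟩ : ∃ Bf : Ω → ℝ, Bf = fun ω => 2 / ((n:ℝ) * (n + 1)) *
    (C0 + zx ω + zy ω + v1 ω + v2 ω + v3 ω) := ⟨_, rfl⟩
  have hrQ : ∀ ω, ∀ x ∈ X, x ∈ edom g → ∀ y ∈ Y, y ∈ edom J →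
      rQ f g Φ J (xb (n + 1) ω) (yb (n + 1) ω) x y ≤ Bf ω := by
    intro ω x hx hxg y hy hyJ
    have h := mul_le_mul_of_nonneg_left (hpath ω x hx hxg y hy hyJ)
      (by positivity : (0:ℝ) ≤ 2 / ((n:ℝ) * (n + 1)))
    have e : ∀ q : ℝ, 2 / ((n:ℝ) * (n + 1)) * ((n : ℝ) * (n + 1) / 2 * q) = q := by
      intro q; field_simp
    rw [e] at h
    rw [hBf]
    exact h
  have hmem := fun ω => (path ω).1 n hn1
  have hBf0 : ∀ ω, 0 ≤ Bf ω := by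
    intro ω
    have h := hrQ ω _ (hmem ω).1.1 (hmem ω).1.2 _ (hmem ω).2.1 (hmem ω).2.2
    unfold rQ at h
    linarith
  have i0 : Integrable (fun _ : Ω => C0) Pr := integrable_const C0
  have i1 : Integrable (fun ω => C0 + zx ω) Pr := i0.add Zx.1
  have i2 : Integrable (fun ω => C0 + zx ω + zy ω) Pr := i1.add Zy.1
  have i3 : Integrable (fun ω => C0 + zx ω + zy ω + v1 ω) Pr := i2.add V1.1
  have i4 : Integrable (fun ω => C0 + zx ω + zy ω + v1 ω + v2 ω) Pr := i3.add V2.1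
  have i5 : Integrable (fun ω => C0 + zx ω + zy ω + v1 ω + v2 ω + v3 ω) Pr := i4.add V3.1
  have hBfi : Integrable Bf Pr := by rw [hBf]; exact i5.const_mul _
  have hBfv : ∫ ω, Bf ω ∂Pr = 2 / ((n:ℝ) * (n + 1)) *
      (C0 + ∫ ω, v1 ω ∂Pr + ∫ ω, v2 ω ∂Pr + ∫ ω, v3 ω ∂Pr) := by
    rw [hBf, integral_const_mul, integral_add i4 V3.1, integral_add i3 V2.1,
      integral_add i2 V1.1, integral_add i1 Zy.1, integral_add i0 Zx.1, IZx, IZy]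
    simp
  calc ∫⁻ ω, toENN (spGap X Y f g Φ J (xb (n + 1) ω) (yb (n + 1) ω)) ∂Pr
      ≤ ∫⁻ ω, ENNReal.ofReal (Bf ω) ∂Pr :=
        lintegral_mono fun ω => gap_le hg hJ (hmem ω).1 (hmem ω).2 (hrQ ω)
    _ = ENNReal.ofReal (∫ ω, Bf ω ∂Pr) :=
        (ofReal_integral_eq_lintegral_ofReal hBfi (Eventually.of_forall hBf0)).symm
    _ ≤ _ := by
        refine ENNReal.ofReal_le_ofReal ?_
        rw [hBfv]
        have hfs := final_scalar (L := L) (M := Lxx + Lyx) (Λ := Lyx + Lyy) (OX := ΩX) (OY := ΩY)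
          hn1r (rfl : (n:ℝ) + 1 = n + 1) hL (by positivity) (by positivity) hOX hOY hσy hσx hρ hρ'
          hA hB
        rw [← hlx, ← hly, ← hC0] at hfs
        push_cast
        rw [add_comm σxf σxΦ, ← hσxdef]
        refine le_trans (mul_le_mul_of_nonneg_left ?_ (by positivity)) hfs
        linarith
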